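/- For every integer s ≥ 1, dim_{F_2}(QP_4)_{2^{s+1}−2} equals 6 if s = 1, equals 24 if s = 2, equals 50 if s = 3, equals 70 if s = 4, and equals 80 if s ≥ 5. -/

import Mathlib

open MvPolynomial

/-- The total Steenrod square on `P_k = F_2[x_1,…,x_k]`, the algebra map with
`Sq(x_j) = x_j + x_j^2`. -/
noncomputable def SqTotal (k : ℕ) :
    MvPolynomial (Fin k) (ZMod 2) →ₐ[ZMod 2] MvPolynomial (Fin k) (ZMod 2) :=
  aeval fun j => X j + X j ^ 2

/-- The Steenrod square `Sq^i : P_k → P_k`, sending a homogeneous polynomial `f` of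
degree `d` to the degree-`d + i` homogeneous component of `Sq(f)`, extended additively. -/
noncomputable def SqOp (k i : ℕ) (f : MvPolynomial (Fin k) (ZMod 2)) :
    MvPolynomial (Fin k) (ZMod 2) :=
  ∑ d ∈ Finset.range (f.totalDegree + 1),
    homogeneousComponent (d + i) (SqTotal k (homogeneousComponent d f))

/-- The space of hit polynomials: finite sums of `Sq^i (f_i)` with `i > 0`. -/
noncomputable def hitSubmodule (k : ℕ) :
    Submodule (ZMod 2) (MvPolynomial (Fin k) (ZMod 2)) :=
  Submodule.span (ZMod 2) {g | ∃ i f, 0 < i ∧ g = SqOp k i f}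

/-- A polynomial is hit if it is a finite sum of `Sq^i (f_i)` with `i > 0`. -/
def IsHit (k : ℕ) (f : MvPolynomial (Fin k) (ZMod 2)) : Prop := f ∈ hitSubmodule k

/-- `(QP_k)_n`: the space of homogeneous polynomials of degree `n` modulo hit polynomials. -/
abbrev QP (k n : ℕ) :=
  ↥(homogeneousSubmodule (Fin k) (ZMod 2) n) ⧸
    ((hitSubmodule k).comap (homogeneousSubmodule (Fin k) (ZMod 2) n).subtype)

namespace HitProblem

/-- The polynomial algebra `P_k` over `F_2`. -/
abbrev Poly (k : ℕ) := MvPolynomial (Fin k) (ZMod 2)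

/-- The Steenrod squares `Sq^i` collected into one power series in a formal variable. -/
noncomputable def sqSeries (k : ℕ) : Poly k →ₐ[ZMod 2] Polynomial (Poly k) :=
  aeval fun j => Polynomial.C (X j) + Polynomial.C (X j ^ 2) * Polynomial.X

/-- The Steenrod square `Sq^i` as a linear map. -/
noncomputable def sq {k : ℕ} (i : ℕ) : Poly k →ₗ[ZMod 2] Poly k :=
  ((Polynomial.lcoeff (Poly k) i).restrictScalars (ZMod 2)).comp (sqSeries k).toLinearMap

theorem sq_apply {k : ℕ} (i : ℕ) (f : Poly k) : sq i f = (sqSeries k f).coeff i := rfl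

theorem sqSeries_X {k : ℕ} (j : Fin k) :
    sqSeries k (X j) = Polynomial.C (X j) + Polynomial.C (X j ^ 2) * Polynomial.X := by
  simp [sqSeries]

theorem sq_mul {k : ℕ} (i : ℕ) (f g : Poly k) :
    sq i (f * g) = ∑ p ∈ Finset.HasAntidiagonal.antidiagonal i, sq p.1 f * sq p.2 g := by
  simp only [sq_apply, map_mul, Polynomial.coeff_mul]

/-- A polynomial in the formal variable whose `i`-th coefficient is homogeneous of
degree `d + i`. -/
def IsGraded {k : ℕ} (d : ℕ) (p : Polynomial (Poly k)) : Prop :=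
  ∀ i, (p.coeff i).IsHomogeneous (d + i)

theorem IsGraded.mul {k d e : ℕ} {p q : Polynomial (Poly k)} (hp : IsGraded d p)
    (hq : IsGraded e q) : IsGraded (d + e) (p * q) := by
  intro i
  rw [Polynomial.coeff_mul]
  refine IsHomogeneous.sum _ _ _ fun x hx => ?_
  have := Finset.HasAntidiagonal.mem_antidiagonal.1 hx
  have h := (hp x.1).mul (hq x.2)
  rwa [show d + x.1 + (e + x.2) = d + e + i by omega] at h

theorem isGraded_one {k : ℕ} : IsGraded 0 (1 : Polynomial (Poly k)) := by
  intro i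
  rw [Polynomial.coeff_one]
  split_ifs with h
  · subst h
    exact isHomogeneous_one _ _
  · exact isHomogeneous_zero _ _ _

theorem IsGraded.pow {k d : ℕ} {p : Polynomial (Poly k)} (hp : IsGraded d p) (n : ℕ) :
    IsGraded (n * d) (p ^ n) := by
  induction n with
  | zero => simpa using isGraded_one
  | succ n ih => simpa [pow_succ, add_mul] using ih.mul hp

theorem IsGraded.prod {k : ℕ} {ι : Type*} (s : Finset ι) (d : ι → ℕ)
    (p : ι → Polynomial (Poly k)) (hp : ∀ j ∈ s, IsGraded (d j) (p j)) :
    IsGraded (∑ j ∈ s, d j) (∏ j ∈ s, p j) := by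
  classical
  induction s using Finset.induction_on with
  | empty => simpa using isGraded_one
  | insert a s ha ih =>
    rw [Finset.sum_insert ha, Finset.prod_insert ha]
    exact (hp a (Finset.mem_insert_self _ _)).mul
      (ih fun j hj => hp j (Finset.mem_insert_of_mem hj))

theorem isGraded_sqSeries_X {k : ℕ} (j : Fin k) : IsGraded 1 (sqSeries k (X j)) := by
  intro i
  rw [sqSeries_X]
  rcases i with _ | _ | i
  · simpa using isHomogeneous_X (ZMod 2) j
  · simpa [-map_pow] using isHomogeneous_X_pow (R := ZMod 2) j 2
  · simpa [-map_pow, Polynomial.coeff_C, Polynomial.coeff_X] using isHomogeneous_zero _ _ _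

theorem isHomogeneous_sq {k d : ℕ} {f : Poly k} (hf : f.IsHomogeneous d) (i : ℕ) :
    (sq i f).IsHomogeneous (d + i) := by
  classical
  rw [f.as_sum, map_sum]
  refine IsHomogeneous.sum _ _ _ fun a ha => ?_
  have hd : d = ∑ j ∈ a.support, a j * 1 := by
    simpa using hf.degree_eq_sum_deg_support ha
  have h : IsGraded d (∏ j ∈ a.support, sqSeries k (X j) ^ a j) := by
    rw [hd]
    exact IsGraded.prod _ _ _ fun j _ => (isGraded_sqSeries_X j).pow _
  rw [sq_apply, monomial_eq, map_mul, Finsupp.prod, map_prod]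
  simp only [map_pow, algHom_C, Polynomial.algebraMap_apply, Polynomial.coeff_C_mul]
  simpa using (isHomogeneous_C _ _).mul (h i)

theorem SqTotal_eq_eval {k : ℕ} (f : Poly k) :
    SqTotal k f = (sqSeries k f).eval 1 := by
  have h : SqTotal k =
      ((Polynomial.aeval (R := Poly k) (1 : Poly k)).restrictScalars (ZMod 2)).comp
        (sqSeries k) := by
    ext j
    simp [SqTotal, sqSeries]
  rw [h]
  simp [Polynomial.coe_aeval_eq_eval]

theorem homogeneousComponent_SqTotal {k d : ℕ} (i : ℕ) {f : Poly k} (hf : f.IsHomogeneous d) :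
    homogeneousComponent (d + i) (SqTotal k f) = sq i f := by
  rw [SqTotal_eq_eval, Polynomial.eval_eq_sum_range, map_sum]
  have h : ∀ j, homogeneousComponent (d + i) ((sqSeries k f).coeff j * 1 ^ j) =
      if j = i then sq i f else 0 := by
    intro j
    rw [one_pow, mul_one, ← sq_apply, homogeneousComponent_of_mem (isHomogeneous_sq hf j)]
    by_cases hj : j = i
    · subst hj
      simp [sq_apply]
    · rw [if_neg (by omega), if_neg hj]
  simp only [h, Finset.sum_ite_eq', Finset.mem_range]
  split_ifs with hi
  · rfl
  · rw [not_lt, Nat.succ_le_iff] at hi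
    exact (Polynomial.coeff_eq_zero_of_natDegree_lt hi).symm

theorem SqOp_eq_sq {k : ℕ} (i : ℕ) (f : Poly k) : SqOp k i f = sq i f := by
  rw [SqOp]
  conv_rhs => rw [← sum_homogeneousComponent f, map_sum]
  exact Finset.sum_congr rfl fun d _ =>
    homogeneousComponent_SqTotal i (homogeneousComponent_isHomogeneous d f)

theorem sq_mem_hit {k i : ℕ} (hi : 0 < i) (f : Poly k) : sq i f ∈ hitSubmodule k :=
  Submodule.subset_span ⟨i, f, hi, (SqOp_eq_sq i f).symm⟩

theorem hit_le {k : ℕ} {N : Submodule (ZMod 2) (Poly k)}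
    (h : ∀ i f, 0 < i → sq i f ∈ N) : hitSubmodule k ≤ N := by
  refine Submodule.span_le.2 ?_
  rintro _ ⟨i, f, hi, rfl⟩
  rw [SqOp_eq_sq]
  exact h i f hi

theorem homogeneousComponent_sq {k : ℕ} (m i : ℕ) (f : Poly k) :
    homogeneousComponent (m + i) (sq i f) = sq i (homogeneousComponent m f) := by
  classical
  conv_lhs => rw [← sum_homogeneousComponent f]
  simp only [map_sum]
  have h : ∀ d, homogeneousComponent (m + i) (sq i (homogeneousComponent d f)) =
      if d = m then sq i (homogeneousComponent m f) else 0 := by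
    intro d
    rw [homogeneousComponent_of_mem
      (isHomogeneous_sq (homogeneousComponent_isHomogeneous d f) i)]
    by_cases hd : d = m
    · simp [hd]
    · rw [if_neg (by omega), if_neg hd]
  simp only [h, Finset.sum_ite_eq', Finset.mem_range]
  split_ifs with hi
  · rfl
  · rw [homogeneousComponent_eq_zero _ _ (by omega), map_zero]

theorem homogeneousComponent_sq_of_lt {k m i : ℕ} (h : m < i) (f : Poly k) :
    homogeneousComponent m (sq i f) = 0 := by
  classical
  conv_lhs => rw [← sum_homogeneousComponent f]
  simp only [map_sum]
  refine Finset.sum_eq_zero fun d _ => ?_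
  rw [homogeneousComponent_of_mem
    (isHomogeneous_sq (homogeneousComponent_isHomogeneous d f) i), if_neg (by omega)]

/-- The hit polynomials of degree `m` are spanned by squares of homogeneous polynomials. -/
theorem mem_span_of_hit {k m : ℕ} {h : Poly k} (hh : h ∈ hitSubmodule k)
    (hm : h.IsHomogeneous m) :
    h ∈ Submodule.span (ZMod 2)
      {g : Poly k | ∃ i d f, 0 < i ∧ f.IsHomogeneous d ∧ d + i = m ∧ g = sq i f} := by
  rw [← homogeneousComponent_eq_self hm]
  have := hit_le (N := (Submodule.span (ZMod 2)
      {g : Poly k | ∃ i d f, 0 < i ∧ f.IsHomogeneous d ∧ d + i = m ∧ g = sq i f}).comap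
        (homogeneousComponent m)) (fun i f hi => ?_)
  · exact this hh
  · rw [Submodule.mem_comap]
    rcases lt_or_ge m i with hmi | hmi
    · rw [homogeneousComponent_sq_of_lt hmi]
      exact zero_mem _
    · obtain ⟨d, rfl⟩ := Nat.exists_eq_add_of_le' hmi
      rw [homogeneousComponent_sq]
      exact Submodule.subset_span
        ⟨i, d, _, hi, homogeneousComponent_isHomogeneous _ _, rfl, rfl⟩

/-- To check that a linear map sends hit polynomials of degree `m` into a submodule it suffices
to consider squares of homogeneous polynomials. -/
theorem map_hit_mem {k m : ℕ} {h : Poly k} (hh : h ∈ hitSubmodule k)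
    (hm : h.IsHomogeneous m) {N : Submodule (ZMod 2) (Poly k)} (φ : Poly k → Poly k)
    (h0 : φ 0 = 0) (hadd : ∀ f g, φ (f + g) = φ f + φ g)
    (hs : ∀ i d (f : Poly k), 0 < i → f.IsHomogeneous d → d + i = m → φ (sq i f) ∈ N) :
    φ h ∈ N := by
  have := mem_span_of_hit hh hm
  clear hh hm
  induction this using Submodule.span_induction with
  | mem x hx =>
    obtain ⟨i, d, f, hi, hf, hd, rfl⟩ := hx
    exact hs i d f hi hf hd
  | zero => rw [h0]; exact zero_mem _
  | add x y _ _ hx hy => rw [hadd]; exact add_mem hx hy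
  | smul a x _ hx =>
    have ha : a = 0 ∨ a = 1 := by revert a; decide
    rcases ha with rfl | rfl
    · rw [zero_smul, h0]; exact zero_mem _
    · rwa [one_smul]

theorem sq_zero {k : ℕ} (f : Poly k) : sq 0 f = f := by
  have h : ((Polynomial.constantCoeff (R := Poly k)).comp (sqSeries k).toRingHom) =
      RingHom.id _ := by
    refine MvPolynomial.ringHom_ext (fun r => ?_) fun j => ?_
    · simp [sqSeries]
    · simp [sqSeries]
  simpa [sq_apply] using DFunLike.congr_fun h f

theorem sq_one_mul {k : ℕ} (f g : Poly k) : sq 1 (f * g) = sq 1 f * g + f * sq 1 g := by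
  rw [sq_mul, show Finset.HasAntidiagonal.antidiagonal 1 = {(0, 1), (1, 0)} from rfl]
  simp [sq_zero, add_comm]

theorem sq_two_mul {k : ℕ} (f g : Poly k) :
    sq 2 (f * g) = sq 2 f * g + sq 1 f * sq 1 g + f * sq 2 g := by
  rw [sq_mul, show Finset.HasAntidiagonal.antidiagonal 2 = {(0, 2), (1, 1), (2, 0)} from rfl]
  simp [sq_zero]
  ring

theorem sq_X_pow {k : ℕ} (i n : ℕ) (j : Fin k) :
    sq i (X j ^ n : Poly k) = (n.choose i : Poly k) * X j ^ (n + i) := by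
  have h : sqSeries k (X j ^ n) = Polynomial.C (X j ^ n) *
      (((Polynomial.X + 1) ^ n).comp (Polynomial.C (X j) * Polynomial.X)) := by
    rw [map_pow, sqSeries_X, map_pow Polynomial.C (X j) n, Polynomial.pow_comp, ← mul_pow]
    congr 1
    simp only [Polynomial.add_comp, Polynomial.X_comp, Polynomial.one_comp, map_pow]
    ring
  rw [sq_apply, h, Polynomial.coeff_C_mul, Polynomial.comp_C_mul_X_coeff,
    Polynomial.coeff_X_add_one_pow]
  ring

theorem sq_bit_sq {k : ℕ} (i : ℕ) (f : Poly k) : sq (2 * i) (f ^ 2) = sq i f ^ 2 := by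
  rw [sq_apply, map_pow, ← Polynomial.map_frobenius_expand, Polynomial.coeff_map, mul_comm,
    Polynomial.coeff_expand_mul (by norm_num)]
  rfl

theorem sq_odd_sq {k : ℕ} (i : ℕ) (f : Poly k) : sq (2 * i + 1) (f ^ 2) = 0 := by
  rw [sq_apply, map_pow, ← Polynomial.map_frobenius_expand, Polynomial.coeff_map,
    Polynomial.coeff_expand (by norm_num), if_neg (by omega), map_zero]

theorem sq_one_sq {k : ℕ} (f : Poly k) : sq 1 (f ^ 2) = 0 := sq_odd_sq 0 f

theorem sq_two_sq {k : ℕ} (f : Poly k) : sq 2 (f ^ 2) = sq 1 f ^ 2 := sq_bit_sq 1 f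

theorem sq_four_sq {k : ℕ} (f : Poly k) : sq 4 (f ^ 2) = sq 2 f ^ 2 := sq_bit_sq 2 f

theorem natDegree_sqSeries_monomial {k : ℕ} (a : Fin k →₀ ℕ) :
    (sqSeries k (monomial a 1)).natDegree ≤ a.degree ∧
      (sqSeries k (monomial a 1)).coeff a.degree = monomial a 1 ^ 2 := by
  induction a using Finsupp.induction_linear with
  | zero => simp
  | add a b ha hb =>
    have h : (monomial (a + b) 1 : Poly k) = monomial a 1 * monomial b 1 := by
      simp [monomial_mul]
    rw [h, map_mul, map_add]
    exact ⟨Polynomial.natDegree_mul_le_of_le ha.1 hb.1, by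
      rw [Polynomial.coeff_mul_add_eq_of_natDegree_le ha.1 hb.1, ha.2, hb.2]; ring⟩
  | single j n =>
    have h1 : (sqSeries k (X j)).natDegree ≤ 1 := by
      rw [sqSeries_X]; compute_degree
    rw [← X_pow_eq_monomial, map_pow, Finsupp.degree_single]
    refine ⟨(Polynomial.natDegree_pow_le_of_le n h1).trans (by simp), ?_⟩
    have h2 := Polynomial.coeff_pow_of_natDegree_le (m := n) h1
    rw [mul_one] at h2
    rw [h2, sqSeries_X]
    simp [-map_pow, Polynomial.coeff_C]
    ring

theorem sq_self {k d : ℕ} {f : Poly k} (hf : f.IsHomogeneous d) : sq d f = f ^ 2 := by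
  classical
  conv_rhs => rw [f.as_sum]
  conv_lhs => rw [f.as_sum]
  rw [map_sum, sum_pow_char]
  refine Finset.sum_congr rfl fun a ha => ?_
  have hd : a.degree = d := by
    rw [hf.degree_eq_sum_deg_support ha]; rfl
  have h1 : coeff a f = 1 := by
    have : coeff a f ≠ 0 := mem_support_iff.1 ha
    revert this; generalize coeff a f = c; revert c; decide
  rw [h1, ← hd, sq_apply]
  exact (natDegree_sqSeries_monomial a).2

theorem sq_mem_hit_of_isHomogeneous {k d : ℕ} {f : Poly k} (hf : f.IsHomogeneous d) (hd : 0 < d) :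
    f ^ 2 ∈ hitSubmodule k :=
  sq_self hf ▸ sq_mem_hit hd f

theorem X_mul_sq_mem_hit {k : ℕ} (i : Fin k) (f : Poly k) : (X i * f) ^ 2 ∈ hitSubmodule k := by
  rw [← sum_homogeneousComponent f, Finset.mul_sum, sum_pow_char]
  exact sum_mem fun d _ => sq_mem_hit_of_isHomogeneous
    ((isHomogeneous_X _ i).mul (homogeneousComponent_isHomogeneous d f)) (by omega)

theorem sqSeries_sq_coeff_bit {k : ℕ} (i : ℕ) (f : Poly k) :
    (sqSeries k f ^ 2).coeff (2 * i) = sq i f ^ 2 := by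
  rw [← map_pow, ← sq_apply, sq_bit_sq]

theorem sqSeries_sq_coeff_odd {k : ℕ} (i : ℕ) (f : Poly k) :
    (sqSeries k f ^ 2).coeff (2 * i + 1) = 0 := by
  rw [← map_pow, ← sq_apply, sq_odd_sq]

theorem X_pow_two_pow_mul_sq_mem_hit {k e : ℕ} (i : Fin k) (he : Even e) (h0 : 0 < e)
    (u : Poly k) (m : ℕ) :
    ∀ n, m + 2 ^ n = e + 1 → X i ^ 2 ^ n * sq m u ∈ hitSubmodule k := by
  induction m using Nat.strong_induction_on with
  | _ m ih =>
    intro n hn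
    have hm : 0 < m := by
      rcases Nat.eq_zero_or_pos m with rfl | h
      · rcases n with _ | n
        · simp at hn; omega
        · rw [zero_add, pow_succ] at hn
          obtain ⟨c, rfl⟩ := he
          omega
      · exact h
    have h1 : sqSeries k (X i ^ 2 ^ n) = Polynomial.C (X i ^ 2 ^ n) +
        Polynomial.C (X i ^ 2 ^ (n + 1)) * Polynomial.X ^ 2 ^ n := by
      rw [map_pow, sqSeries_X, add_pow_char_pow, mul_pow, ← Polynomial.C_pow, ← Polynomial.C_pow,
        ← pow_mul, pow_succ' 2 n]
    have h2 := sq_mem_hit hm (X i ^ 2 ^ n * u)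
    rw [sq_apply, map_mul, h1, add_mul, Polynomial.coeff_add, Polynomial.coeff_C_mul, mul_assoc,
      Polynomial.coeff_C_mul, Polynomial.coeff_X_pow_mul', ← sq_apply] at h2
    split_ifs at h2 with hmn
    · have h3 := ih (m - 2 ^ n) (Nat.sub_lt hm (by positivity)) (n + 1) (by
        rw [pow_succ]; omega)
      exact (Submodule.add_mem_iff_left _ h3).1 h2
    · simpa using h2

/-- A variable times the square of a polynomial of positive even degree is hit. -/
theorem X_mul_even_sq_mem_hit {k e : ℕ} (i : Fin k) {u : Poly k} (hu : u.IsHomogeneous e)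
    (he : Even e) (h0 : 0 < e) : X i * u ^ 2 ∈ hitSubmodule k := by
  have := X_pow_two_pow_mul_sq_mem_hit i he h0 u e 0 (by simp)
  rwa [pow_zero, pow_one, sq_self hu] at this

theorem hit_induction {k : ℕ} {h : Poly k} (hh : h ∈ hitSubmodule k)
    {N : Submodule (ZMod 2) (Poly k)} (φ : Poly k → Poly k)
    (h0 : φ 0 = 0) (hadd : ∀ f g, φ (f + g) = φ f + φ g)
    (hs : ∀ i (f : Poly k), 0 < i → φ (sq i f) ∈ N) : φ h ∈ N := by
  induction hh using Submodule.span_induction with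
  | mem x hx =>
    obtain ⟨i, f, hi, rfl⟩ := hx
    exact SqOp_eq_sq i f ▸ hs i f hi
  | zero => rw [h0]; exact zero_mem _
  | add x y _ _ hx hy => rw [hadd]; exact add_mem hx hy
  | smul a x _ hx =>
    have ha : a = 0 ∨ a = 1 := by revert a; decide
    rcases ha with rfl | rfl
    · rw [zero_smul, h0]; exact zero_mem _
    · rwa [one_smul]


theorem X_mul_X_mul_hit_sq_mem_hit {k : ℕ} (i j : Fin k) {h : Poly k}
    (hh : h ∈ hitSubmodule k) : X i * X j * h ^ 2 ∈ hitSubmodule k := by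
  refine hit_induction hh (fun h => X i * X j * h ^ 2) (by simp)
    (fun f g => by simp only [add_pow_char]; ring) fun n f hn => ?_
  obtain ⟨n, rfl⟩ := Nat.exists_eq_succ_of_ne_zero hn.ne'
  have h1 : sqSeries k (X i * X j * f ^ 2) =
      Polynomial.C (X i * X j) * sqSeries k f ^ 2 +
      Polynomial.C (X i * X j * (X i + X j)) * (sqSeries k f ^ 2 * Polynomial.X ^ 1) +
      Polynomial.C ((X i * X j) ^ 2) * (sqSeries k f ^ 2 * Polynomial.X ^ 2) := by
    simp only [map_mul, sqSeries_X, map_pow, map_add]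
    ring
  have h2 : sq (2 * (n + 1)) (X i * X j * f ^ 2) =
      X i * X j * sq (n + 1) f ^ 2 + (X i * (X j * sq n f)) ^ 2 := by
    rw [sq_apply, h1]
    simp only [Polynomial.coeff_add, Polynomial.coeff_C_mul, Polynomial.coeff_mul_X_pow']
    rw [if_pos (by omega), if_pos (by omega), show 2 * (n + 1) - 1 = 2 * n + 1 by omega,
      show 2 * (n + 1) - 2 = 2 * n by omega, sqSeries_sq_coeff_bit, sqSeries_sq_coeff_odd,
      sqSeries_sq_coeff_bit]
    ring
  exact (Submodule.add_mem_iff_left _ (X_mul_sq_mem_hit _ _)).1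
    (h2 ▸ sq_mem_hit (by omega) (X i * X j * f ^ 2))

theorem X_mul_X_mul_X_mul_hit_sq_mem_hit {k m : ℕ} (i j l : Fin k) {h : Poly k}
    (hh : h ∈ hitSubmodule k) (hm : h.IsHomogeneous m) (hodd : Odd m) :
    X i * X j * X l * h ^ 2 ∈ hitSubmodule k := by
  refine map_hit_mem hh hm (fun h => X i * X j * X l * h ^ 2) (by simp)
    (fun f g => by simp only [add_pow_char]; ring) fun n d f hn hf hd => ?_
  obtain ⟨n, rfl⟩ := Nat.exists_eq_succ_of_ne_zero hn.ne'
  have h1 : sqSeries k (X i * X j * X l * f ^ 2) =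
      Polynomial.C (X i * X j * X l) * sqSeries k f ^ 2 +
      Polynomial.C (X i * X j * X l * (X i + X j + X l)) *
        (sqSeries k f ^ 2 * Polynomial.X ^ 1) +
      Polynomial.C (X i * X j * X l * (X i * X j + X i * X l + X j * X l)) *
        (sqSeries k f ^ 2 * Polynomial.X ^ 2) +
      Polynomial.C ((X i * X j * X l) ^ 2) * (sqSeries k f ^ 2 * Polynomial.X ^ 3) := by
    simp only [map_mul, sqSeries_X, map_pow, map_add]
    ring
  have h2 : sq (2 * (n + 1)) (X i * X j * X l * f ^ 2) =
      X i * X j * X l * sq (n + 1) f ^ 2 + (X l * (X i * X j * sq n f) ^ 2 +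
        X j * (X i * X l * sq n f) ^ 2 + X i * (X j * X l * sq n f) ^ 2) := by
    rw [sq_apply, h1]
    simp only [Polynomial.coeff_add, Polynomial.coeff_C_mul, Polynomial.coeff_mul_X_pow']
    rw [if_pos (by omega), if_pos (by omega), show 2 * (n + 1) - 1 = 2 * n + 1 by omega,
      show 2 * (n + 1) - 2 = 2 * n by omega, sqSeries_sq_coeff_bit, sqSeries_sq_coeff_odd,
      sqSeries_sq_coeff_bit]
    split_ifs with h3
    · obtain ⟨n, rfl⟩ := Nat.exists_eq_succ_of_ne_zero (show n ≠ 0 by omega)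
      rw [show 2 * (n + 1 + 1) - 3 = 2 * n + 1 by omega, sqSeries_sq_coeff_odd]
      ring
    · ring
  have h3 : ∀ a b c : Fin k, X a * (X b * X c * sq n f) ^ 2 ∈ hitSubmodule k := fun a b c =>
    X_mul_even_sq_mem_hit a
      (((isHomogeneous_X _ b).mul (isHomogeneous_X _ c)).mul (isHomogeneous_sq hf n))
      (by rw [show 1 + 1 + (d + n) = m + 1 by omega]; exact hodd.add_one) (by omega)
  exact (Submodule.add_mem_iff_left _ (add_mem (add_mem (h3 _ _ _) (h3 _ _ _)) (h3 _ _ _))).1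
    (h2 ▸ sq_mem_hit (by omega) (X i * X j * X l * f ^ 2))

theorem X_prod_mul_hit_sq_mem {m : ℕ} {h : Poly 4} (hh : h ∈ hitSubmodule 4)
    (hm : h.IsHomogeneous m) {N : Submodule (ZMod 2) (Poly 4)} (hN : hitSubmodule 4 ≤ N)
    (hz : ∀ (i j : Fin 4) (z : Poly 4), i < j → z.IsHomogeneous (m + 1) → X i * X j * z ^ 2 ∈ N) :
    X 0 * X 1 * X 2 * X 3 * h ^ 2 ∈ N := by
  refine map_hit_mem hh hm (fun h => X 0 * X 1 * X 2 * X 3 * h ^ 2) (by simp)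
    (fun f g => by simp only [add_pow_char]; ring) fun n d f hn hf hd => ?_
  obtain ⟨n, rfl⟩ := Nat.exists_eq_succ_of_ne_zero hn.ne'
  have h1 : sqSeries 4 (X 0 * X 1 * X 2 * X 3 * f ^ 2) =
      Polynomial.C (X 0 * X 1 * X 2 * X 3) * sqSeries 4 f ^ 2 +
      Polynomial.C (X 0 * X 1 * X 2 * X 3 * (X 0 + X 1 + X 2 + X 3)) *
        (sqSeries 4 f ^ 2 * Polynomial.X ^ 1) +
      Polynomial.C (X 0 * X 1 * X 2 * X 3 *
        (X 0 * X 1 + X 0 * X 2 + X 0 * X 3 + X 1 * X 2 + X 1 * X 3 + X 2 * X 3)) *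
        (sqSeries 4 f ^ 2 * Polynomial.X ^ 2) +
      Polynomial.C (X 0 * X 1 * X 2 * X 3 *
        (X 0 * X 1 * X 2 + X 0 * X 1 * X 3 + X 0 * X 2 * X 3 + X 1 * X 2 * X 3)) *
        (sqSeries 4 f ^ 2 * Polynomial.X ^ 3) +
      Polynomial.C ((X 0 * X 1 * X 2 * X 3) ^ 2) * (sqSeries 4 f ^ 2 * Polynomial.X ^ 4) := by
    simp only [map_mul, sqSeries_X, map_pow, map_add]
    ring
  have h2 : ∃ g : Poly 4, sq (2 * (n + 1)) (X 0 * X 1 * X 2 * X 3 * f ^ 2) =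
      X 0 * X 1 * X 2 * X 3 * sq (n + 1) f ^ 2 + (X 2 * X 3 * (X 0 * X 1 * sq n f) ^ 2 +
        X 1 * X 3 * (X 0 * X 2 * sq n f) ^ 2 + X 1 * X 2 * (X 0 * X 3 * sq n f) ^ 2 +
        X 0 * X 3 * (X 1 * X 2 * sq n f) ^ 2 + X 0 * X 2 * (X 1 * X 3 * sq n f) ^ 2 +
        X 0 * X 1 * (X 2 * X 3 * sq n f) ^ 2 + (X 0 * g) ^ 2) := by
    rw [sq_apply, h1]
    simp only [Polynomial.coeff_add, Polynomial.coeff_C_mul, Polynomial.coeff_mul_X_pow']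
    rw [if_pos (by omega), if_pos (by omega), show 2 * (n + 1) - 1 = 2 * n + 1 by omega,
      show 2 * (n + 1) - 2 = 2 * n by omega, sqSeries_sq_coeff_bit, sqSeries_sq_coeff_odd,
      sqSeries_sq_coeff_bit]
    rcases n with _ | n
    · refine ⟨0, ?_⟩
      rw [if_neg (by omega), if_neg (by omega)]
      ring
    · refine ⟨X 1 * X 2 * X 3 * sq n f, ?_⟩
      rw [if_pos (by omega), if_pos (by omega), show 2 * (n + 1 + 1) - 3 = 2 * n + 1 by omega,
        show 2 * (n + 1 + 1) - 4 = 2 * n by omega, sqSeries_sq_coeff_odd, sqSeries_sq_coeff_bit]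
      ring
  obtain ⟨g, h2⟩ := h2
  have h3 : ∀ a b c e : Fin 4, a < b → X a * X b * (X c * X e * sq n f) ^ 2 ∈ N := by
    intro a b c e hab
    refine hz a b _ hab ?_
    have := ((isHomogeneous_X (ZMod 2) c).mul (isHomogeneous_X _ e)).mul (isHomogeneous_sq hf n)
    rwa [show 1 + 1 + (d + n) = m + 1 by omega] at this
  refine (Submodule.add_mem_iff_left _ ?_).1
    (h2 ▸ hN (sq_mem_hit (by omega) (X 0 * X 1 * X 2 * X 3 * f ^ 2)))
  refine add_mem (add_mem (add_mem (add_mem (add_mem (add_mem ?_ ?_) ?_) ?_) ?_) ?_)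
    (hN (X_mul_sq_mem_hit _ _)) <;> exact h3 _ _ _ _ (by decide)

theorem two_eq_zero (k : ℕ) : (2 : Poly k) = 0 := by
  exact_mod_cast CharP.cast_eq_zero (Poly k) 2

theorem sq_one_X {k : ℕ} (i : Fin k) : sq 1 (X i : Poly k) = X i ^ 2 := by
  simpa using sq_X_pow 1 1 i

theorem sq_two_X {k : ℕ} (i : Fin k) : sq 2 (X i : Poly k) = 0 := by
  simpa using sq_X_pow 2 1 i

theorem sq_one_pow_four {k : ℕ} (g : Poly k) : sq 1 (g ^ 4) = 0 := by
  rw [show g ^ 4 = (g ^ 2) ^ 2 by ring, sq_one_sq]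

theorem sq_two_pow_four {k : ℕ} (g : Poly k) : sq 2 (g ^ 4) = 0 := by
  rw [show g ^ 4 = (g ^ 2) ^ 2 by ring, sq_two_sq, sq_one_sq, zero_pow two_ne_zero]

theorem sq_one_pow_eight {k : ℕ} (g : Poly k) : sq 1 (g ^ 8) = 0 := by
  rw [show g ^ 8 = (g ^ 2) ^ 4 by ring, sq_one_pow_four]

theorem sq_two_pow_eight {k : ℕ} (g : Poly k) : sq 2 (g ^ 8) = 0 := by
  rw [show g ^ 8 = (g ^ 2) ^ 4 by ring, sq_two_pow_four]

theorem sq_four_sq_mul {k : ℕ} (f g : Poly k) :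
    sq 4 (f ^ 2 * g) = sq 2 f ^ 2 * g + sq 1 f ^ 2 * sq 2 g + f ^ 2 * sq 4 g := by
  rw [sq_mul, show Finset.HasAntidiagonal.antidiagonal 4 =
    {(0, 4), (1, 3), (2, 2), (3, 1), (4, 0)} from rfl]
  simp [sq_zero, sq_one_sq, sq_two_sq, sq_four_sq, show sq 3 (f ^ 2) = 0 from sq_odd_sq 1 f]
  ring

theorem swap_mem_hit {k : ℕ} (a b c d : Fin k) (g : Poly k) :
    X a * X b * (X c * X d * g ^ 2) ^ 2 + X c * X d * (X a * X b * g ^ 2) ^ 2 ∈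
      hitSubmodule k := by
  have h : X a * X b * (X c * X d * g ^ 2) ^ 2 + X c * X d * (X a * X b * g ^ 2) ^ 2 =
      sq 2 (X a * X b * X c * X d * g ^ 4) + sq 1 (X a ^ 2 * (X b * X c * X d * g ^ 4)) +
      sq 1 (X b ^ 2 * (X a * X c * X d * g ^ 4)) := by
    simp only [sq_one_mul, sq_two_mul, sq_one_X, sq_two_X, sq_one_pow_four, sq_two_pow_four,
      sq_one_sq]
    have := two_eq_zero k
    grind
  rw [h]
  exact add_mem (add_mem (sq_mem_hit (by norm_num) _) (sq_mem_hit (by norm_num) _))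
    (sq_mem_hit (by norm_num) _)

theorem three_term_mem_hit {k : ℕ} (a b c d : Fin k) (g : Poly k) :
    X a * X b * (X c * X d * g ^ 2) ^ 2 + X a * X c * (X b * X d * g ^ 2) ^ 2 +
      X a * X d * (X b * X c * g ^ 2) ^ 2 ∈ hitSubmodule k := by
  have h : X a * X b * (X c * X d * g ^ 2) ^ 2 + X a * X c * (X b * X d * g ^ 2) ^ 2 +
      X a * X d * (X b * X c * g ^ 2) ^ 2 =
      sq 2 (X a * X b * X c * X d * g ^ 4) + sq 1 (X a ^ 2 * (X b * X c * X d * g ^ 4)) := by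
    simp only [sq_one_mul, sq_two_mul, sq_one_X, sq_two_X, sq_one_pow_four, sq_two_pow_four,
      sq_one_sq]
    have := two_eq_zero k
    grind
  rw [h]
  exact add_mem (sq_mem_hit (by norm_num) _) (sq_mem_hit (by norm_num) _)

theorem sq_one_X_pow {k : ℕ} (n : ℕ) (i : Fin k) : 
    sq 1 (X i ^ n : Poly k) = (n : Poly k) * X i ^ (n + 1) := by
  rw [sq_X_pow, Nat.choose_one_right]

theorem exchange_identity {k : ℕ} (a b : Fin k) (y : Poly k) :
    X a ^ 3 * X b ^ 4 * y + X a * X b ^ 6 * y =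
      sq 1 (X a * X b ^ 5 * y) + sq 2 (X a ^ 2 * X b ^ 3 * y) + sq 1 (X a ^ 3 * X b ^ 3 * y) +
      (X a * X b ^ 5 * sq 1 y + X a ^ 2 * X b ^ 3 * sq 2 y + X a ^ 2 * X b ^ 4 * sq 1 y +
        X a ^ 3 * X b ^ 3 * sq 1 y) := by
  simp only [sq_one_mul, sq_two_mul, sq_one_X, sq_X_pow]
  norm_num [Nat.choose]
  have := two_eq_zero k
  grind

theorem overlap_mem_hit {k : ℕ} (r a b : Fin k) (g : Poly k) :
    X r * X a * (X r * X a * (X r * X b * g ^ 2) ^ 2) ^ 2 +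
      X r * X a * (X r * X b * (X r * X b * g ^ 2) ^ 2) ^ 2 ∈ hitSubmodule k := by
  have h2 := two_eq_zero k
  have hy : sq 1 (X r ^ 7 * g ^ 8 : Poly k) = X r ^ 8 * g ^ 8 := by
    simp only [sq_one_mul, sq_one_pow_eight, sq_one_X_pow]
    norm_num
    grind
  have hy' : sq 2 (X r ^ 7 * g ^ 8 : Poly k) = X r ^ 9 * g ^ 8 := by
    simp only [sq_two_mul, sq_one_pow_eight, sq_two_pow_eight, sq_X_pow]
    norm_num [Nat.choose]
    grind
  have h := exchange_identity a b (X r ^ 7 * g ^ 8)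
  rw [hy, hy'] at h
  have e : X r * X a * (X r * X a * (X r * X b * g ^ 2) ^ 2) ^ 2 +
      X r * X a * (X r * X b * (X r * X b * g ^ 2) ^ 2) ^ 2 =
      X a ^ 3 * X b ^ 4 * (X r ^ 7 * g ^ 8) + X a * X b ^ 6 * (X r ^ 7 * g ^ 8) := by ring
  rw [e, h]
  have m1 := X_mul_X_mul_hit_sq_mem_hit a b (X_mul_sq_mem_hit b ((X r * g) ^ 2))
  have m2 := X_mul_X_mul_hit_sq_mem_hit b r
    (X_mul_X_mul_hit_sq_mem_hit a b (X_mul_sq_mem_hit r g))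
  have m3 := X_mul_sq_mem_hit a (X b ^ 2 * X r ^ 4 * g ^ 4)
  have m4 := X_mul_X_mul_hit_sq_mem_hit a b
    (X_mul_X_mul_hit_sq_mem_hit a b (X_mul_sq_mem_hit r g))
  refine add_mem (add_mem (add_mem (sq_mem_hit one_pos _) (sq_mem_hit two_pos _))
    (sq_mem_hit one_pos _)) (add_mem (add_mem (add_mem ?_ ?_) ?_) ?_)
  · convert m1 using 1; ring
  · convert m2 using 1; ring
  · convert m3 using 1; ring
  · convert m4 using 1; ring

theorem cubic_relation_mem_hit {k : ℕ} (a b c d : Fin k) :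
    X a * X b * (X c * X d * (X c * X d * 1 ^ 2) ^ 2) ^ 2 +
      X a * X c * (X a * X c * (X b * X d * 1 ^ 2) ^ 2) ^ 2 +
      X a * X d * (X a * X d * (X b * X c * 1 ^ 2) ^ 2) ^ 2 ∈ hitSubmodule k := by
  have h : X a * X b * (X c * X d * (X c * X d * 1 ^ 2) ^ 2) ^ 2 +
      X a * X c * (X a * X c * (X b * X d * 1 ^ 2) ^ 2) ^ 2 +
      X a * X d * (X a * X d * (X b * X c * 1 ^ 2) ^ 2) ^ 2 =
      sq 1 (X a * X b * X c ^ 5 * X d ^ 6) + sq 1 (X a * X b * X c ^ 6 * X d ^ 5) +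
      sq 1 (X a ^ 3 * X b ^ 4 * X c ^ 3 * X d ^ 3) +
      sq 2 (X a * X b * X c ^ 5 * X d ^ 5) + sq 2 (X a ^ 2 * X b ^ 2 * X c ^ 3 * X d ^ 5) +
      sq 2 (X a ^ 2 * X b ^ 2 * X c ^ 4 * X d ^ 4) +
      sq 2 (X a ^ 2 * X b ^ 2 * X c ^ 5 * X d ^ 3) +
      sq 4 ((X a * X b) ^ 2 * (X c ^ 3 * X d ^ 3)) := by
    have e4 : sq 4 (X c ^ 3 * X d ^ 3 : Poly k) =
        X c ^ 6 * X d ^ 4 * 3 + X c ^ 5 * X d ^ 5 * 9 + X c ^ 4 * X d ^ 6 * 3 := by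
      rw [sq_mul, show Finset.HasAntidiagonal.antidiagonal 4 =
        {(0, 4), (1, 3), (2, 2), (3, 1), (4, 0)} from rfl]
      simp [sq_X_pow, Nat.choose]
      ring
    rw [sq_four_sq_mul, e4]
    simp only [sq_one_mul, sq_two_mul, sq_one_X, sq_two_X, sq_X_pow]
    norm_num [Nat.choose]
    have := two_eq_zero k
    grind
  rw [h]
  repeat' apply add_mem
  all_goals exact sq_mem_hit (by norm_num) _

theorem odd_swap_mem_hit {k m : ℕ} (r r' a b : Fin k) {g : Poly k} (hg : g.IsHomogeneous m)
    (hm : Odd m) :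
    X r * X r' * X a * (X r * X r' * X b * g ^ 2) ^ 2 +
      X r * X r' * X b * (X r * X r' * X a * g ^ 2) ^ 2 ∈ hitSubmodule k := by
  have h : X r * X r' * X a * (X r * X r' * X b * g ^ 2) ^ 2 +
      X r * X r' * X b * (X r * X r' * X a * g ^ 2) ^ 2 =
      sq 1 (X r ^ 3 * X r' ^ 3 * X a * X b * g ^ 4) +
      (X r' * X a * X b * (X r' * (X r * g) ^ 2) ^ 2 +
        X r * X a * X b * (X r * (X r' * g) ^ 2) ^ 2) := by
    simp only [sq_one_mul, sq_one_X, sq_one_pow_four, sq_one_X_pow]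
    norm_num
    have := two_eq_zero k
    grind
  have h1 : ∀ r r' : Fin k, X r' * X a * X b * (X r' * (X r * g) ^ 2) ^ 2 ∈ hitSubmodule k := by
    intro r r'
    have hd : (X r * g).IsHomogeneous (1 + m) := (isHomogeneous_X _ r).mul hg
    exact X_mul_X_mul_X_mul_hit_sq_mem_hit r' a b
      (X_mul_even_sq_mem_hit r' hd hm.one_add (by omega))
      ((isHomogeneous_X _ r').mul (hd.pow 2)) ⟨1 + m, by ring⟩
  rw [h]
  exact add_mem (sq_mem_hit one_pos _) (add_mem (h1 _ _) (h1 _ _))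

theorem odd_exchange_mem_hit {k m : ℕ} (r r' a b : Fin k) {g : Poly k} (hg : g.IsHomogeneous m)
    (hm : Odd m) :
    X r * X r' * X a * (X r * X r' * X a * (X r * X r' * X b * g ^ 2) ^ 2) ^ 2 +
      X r * X r' * X a * (X r * X r' * X b * (X r * X r' * X b * g ^ 2) ^ 2) ^ 2 ∈
        hitSubmodule k := by
  have h2 := two_eq_zero k
  have hy : sq 1 (X r ^ 7 * X r' ^ 7 * g ^ 8 : Poly k) =
      X r ^ 8 * X r' ^ 7 * g ^ 8 + X r ^ 7 * X r' ^ 8 * g ^ 8 := by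
    simp only [sq_one_mul, sq_one_pow_eight, sq_one_X_pow]
    norm_num
    grind
  have hy' : sq 2 (X r ^ 7 * X r' ^ 7 * g ^ 8 : Poly k) =
      X r ^ 9 * X r' ^ 7 * g ^ 8 + X r ^ 8 * X r' ^ 8 * g ^ 8 + X r ^ 7 * X r' ^ 9 * g ^ 8 := by
    simp only [sq_one_mul, sq_two_mul, sq_one_pow_eight, sq_two_pow_eight, sq_X_pow]
    norm_num [Nat.choose]
    grind
  have h := exchange_identity a b (X r ^ 7 * X r' ^ 7 * g ^ 8)
  rw [hy, hy'] at h
  have e : X r * X r' * X a * (X r * X r' * X a * (X r * X r' * X b * g ^ 2) ^ 2) ^ 2 +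
      X r * X r' * X a * (X r * X r' * X b * (X r * X r' * X b * g ^ 2) ^ 2) ^ 2 =
      X a ^ 3 * X b ^ 4 * (X r ^ 7 * X r' ^ 7 * g ^ 8) +
        X a * X b ^ 6 * (X r ^ 7 * X r' ^ 7 * g ^ 8) := by ring
  have hX := fun i : Fin k => isHomogeneous_X (ZMod 2) i
  have w : ∀ r r' : Fin k, X r' * (X r * g) ^ 2 ∈ hitSubmodule k ∧
      (X r' * (X r * g) ^ 2).IsHomogeneous (1 + (1 + m) * 2) := fun r r' =>
    ⟨X_mul_even_sq_mem_hit r' ((hX r).mul hg) hm.one_add (by omega),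
      (hX r').mul (((hX r).mul hg).pow 2)⟩
  have m1 : ∀ r r' : Fin k, X a * X b ^ 5 * (X r ^ 8 * X r' ^ 7 * g ^ 8) ∈ hitSubmodule k := by
    intro r r'
    have hd : (X b * (X r' * (X r * g) ^ 2)).IsHomogeneous (1 + (1 + (1 + m) * 2)) :=
      (hX b).mul (w r r').2
    have := X_mul_X_mul_X_mul_hit_sq_mem_hit a b r'
      (X_mul_even_sq_mem_hit r' hd ⟨2 + m, by ring⟩ (by omega))
      ((hX r').mul (hd.pow 2)) ⟨_, add_comm _ _ |>.trans (congrArg (· + 1) (mul_comm _ 2))⟩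
    convert this using 1
    ring
  have m2 : ∀ r r' : Fin k, X a ^ 2 * X b ^ 3 * (X r ^ 9 * X r' ^ 7 * g ^ 8) ∈
      hitSubmodule k := by
    intro r r'
    have h1 := X_mul_X_mul_X_mul_hit_sq_mem_hit a b r' (w r r').1 (w r r').2 ⟨1 + m, by ring⟩
    have := X_mul_X_mul_X_mul_hit_sq_mem_hit b r r' h1
      ((((hX a).mul (hX b)).mul (hX r')).mul ((w r r').2.pow 2)) ⟨4 + 2 * m, by ring⟩
    convert this using 1
    ring
  have m3 : X a ^ 2 * X b ^ 3 * (X r ^ 8 * X r' ^ 8 * g ^ 8) ∈ hitSubmodule k := by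
    have hd : (X a * X b * (X r * X r' * g) ^ 4).IsHomogeneous (1 + 1 + (1 + 1 + m) * 4) :=
      ((hX a).mul (hX b)).mul ((((hX r).mul (hX r')).mul hg).pow 4)
    have := X_mul_even_sq_mem_hit b hd ⟨5 + 2 * m, by ring⟩ (by omega)
    convert this using 1
    ring
  have m4 : ∀ r r' : Fin k, X a ^ 2 * X b ^ 4 * (X r ^ 8 * X r' ^ 7 * g ^ 8) ∈
      hitSubmodule k := by
    intro r r'
    have hd : (X a * X b ^ 2 * X r ^ 4 * X r' ^ 3 * g ^ 4).IsHomogeneous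
        (1 + 1 * 2 + 1 * 4 + 1 * 3 + m * 4) :=
      (((((hX a).mul ((hX b).pow 2)).mul ((hX r).pow 4)).mul ((hX r').pow 3)).mul (hg.pow 4))
    have := X_mul_even_sq_mem_hit r' hd ⟨5 + 2 * m, by ring⟩ (by omega)
    convert this using 1
    ring
  have m5 : ∀ r r' : Fin k, X a ^ 3 * X b ^ 3 * (X r ^ 8 * X r' ^ 7 * g ^ 8) ∈
      hitSubmodule k := by
    intro r r'
    have h1 := X_mul_X_mul_X_mul_hit_sq_mem_hit a b r' (w r r').1 (w r r').2 ⟨1 + m, by ring⟩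
    have := X_mul_X_mul_X_mul_hit_sq_mem_hit a b r' h1
      ((((hX a).mul (hX b)).mul (hX r')).mul ((w r r').2.pow 2)) ⟨4 + 2 * m, by ring⟩
    convert this using 1
    ring
  have swap : ∀ c : Poly k, (∀ r r' : Fin k, c * (X r ^ 8 * X r' ^ 7 * g ^ 8) ∈ hitSubmodule k) →
      c * (X r ^ 8 * X r' ^ 7 * g ^ 8 + X r ^ 7 * X r' ^ 8 * g ^ 8) ∈ hitSubmodule k := by
    intro c hc
    rw [mul_add, mul_comm (X r ^ 7) (X r' ^ 8)]
    exact add_mem (hc r r') (hc r' r)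
  rw [e, h]
  refine add_mem (add_mem (add_mem (sq_mem_hit one_pos _) (sq_mem_hit two_pos _))
    (sq_mem_hit one_pos _)) (add_mem (add_mem (add_mem (swap _ m1) ?_) (swap _ m4)) (swap _ m5))
  rw [mul_add, mul_add, mul_comm (X r ^ 7) (X r' ^ 9)]
  exact add_mem (add_mem (m2 r r') m3) (m2 r' r)

theorem mkQ_eq_mkQ {k : ℕ} {N : Submodule (ZMod 2) (Poly k)} {f g : Poly k} :
    N.mkQ f = N.mkQ g ↔ f + g ∈ N := by
  rw [← sub_eq_zero, ← map_sub, ← LinearMap.mem_ker, N.ker_mkQ, CharTwo.sub_eq_add]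

/-- A function on lists which is invariant under permutations and under exchanging
`p, p, q` with `p, q, q` depends, in a fixed length, only on the set of entries. -/
theorem eq_of_toFinset_eq {α M : Type*} [DecidableEq α] {c : List α → M} {s : ℕ}
    (hperm : ∀ l l' : List α, l.Perm l' → c l = c l')
    (hex : ∀ p q (l : List α), p ≠ q → l.length + 3 = s → c (p :: p :: q :: l) =
      c (p :: q :: q :: l))
    {l l' : List α} (hl : l.length = s) (hl' : l'.length = s)
    (h : l.toFinset = l'.toFinset) : c l = c l' := by
  suffices H : ∀ (n : ℕ) (u v v' : List α), v.length = n → v'.length = n → n + u.length = s →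
      v.toFinset = v'.toFinset → c (v ++ u) = c (v' ++ u) by
    simpa using H s [] l l' hl hl' rfl h
  intro n
  induction n with
  | zero =>
    intro u v v' hv hv' _ _
    rw [List.length_eq_zero_iff.1 hv, List.length_eq_zero_iff.1 hv']
  | succ n ih =>
    intro u v v' hv hv' hs hvv'
    by_cases hd : v.Nodup
    · have hd' : v'.Nodup := by
        rw [← Multiset.coe_nodup, ← Multiset.toFinset_card_eq_card_iff_nodup]
        rw [← Multiset.coe_nodup, ← Multiset.toFinset_card_eq_card_iff_nodup] at hd
        simp only [List.toFinset_coe, Multiset.coe_card] at hd ⊢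
        rw [← hvv', hd, hv, hv']
      exact hperm _ _ ((List.perm_of_nodup_nodup_toFinset_eq hd hd' hvv').append_right u)
    · have hd' : ¬ v'.Nodup := by
        rw [← Multiset.coe_nodup, ← Multiset.toFinset_card_eq_card_iff_nodup] at hd ⊢
        simp only [List.toFinset_coe, Multiset.coe_card] at hd ⊢
        rwa [← hvv', hv', ← hv]
      have dup : ∀ w : List α, ¬ w.Nodup → ∃ x w₁, w.Perm (x :: w₁) ∧ x ∈ w₁ := by
        intro w hw
        obtain ⟨x, hx⟩ := List.exists_duplicate_iff_not_nodup.2 hw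
        refine ⟨x, w.erase x, List.perm_cons_erase hx.mem, ?_⟩
        rw [← List.count_pos_iff, List.count_erase_self]
        have := List.duplicate_iff_two_le_count.1 hx
        omega
      obtain ⟨x, v₁, hx, hxm⟩ := dup v hd
      obtain ⟨y, v₂, hy, hym⟩ := dup v' hd'
      have hv₁ : v₁.length = n := by have := hx.length_eq; simp at this; omega
      have hv₂ : v₂.length = n := by have := hy.length_eq; simp at this; omega
      have h12 : v₁.toFinset = v₂.toFinset := by
        have h1 := List.toFinset_eq_of_perm _ _ hx
        have h2 := List.toFinset_eq_of_perm _ _ hy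
        rw [List.toFinset_cons, Finset.insert_eq_of_mem (List.mem_toFinset.2 hxm)] at h1
        rw [List.toFinset_cons, Finset.insert_eq_of_mem (List.mem_toFinset.2 hym)] at h2
        rw [← h1, ← h2, hvv']
      have hy1 : y ∈ v₁ := by rwa [← List.mem_toFinset, h12, List.mem_toFinset]
      have key : c (x :: (v₁ ++ u)) = c (y :: (v₁ ++ u)) := by
        by_cases hxy : x = y
        · rw [hxy]
        · have p1 := List.perm_cons_erase hxm
          have p2 := List.perm_cons_erase ((List.mem_erase_of_ne (Ne.symm hxy)).2 hy1)
          have p3 : v₁.Perm (x :: y :: (v₁.erase x).erase y) := p1.trans (p2.cons x)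
          have hlen := p3.length_eq
          simp only [List.length_cons] at hlen
          rw [hperm _ _ ((p3.append_right u).cons x), hperm _ _ ((p3.append_right u).cons y)]
          simp only [List.cons_append]
          rw [hex x y _ hxy (by simp only [List.length_append]; omega)]
          exact hperm _ _ (List.Perm.swap _ _ _)
      have m : ∀ a (w : List α), (a :: (w ++ u)).Perm (w ++ (a :: u)) := fun a w =>
        List.perm_middle.symm
      rw [hperm _ _ (hx.append_right u), hperm _ _ (hy.append_right u), List.cons_append,
        List.cons_append, key, hperm _ _ (m y v₁), hperm _ _ (m y v₂)]
      exact ih (y :: u) v₁ v₂ hv₁ hv₂ (by simp only [List.length_cons]; omega) h12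

/-- The smaller index of the `p`-th pair of variables. -/
def fstIx : Fin 6 → Fin 4 := ![0, 2, 0, 1, 0, 1]

/-- The larger index of the `p`-th pair of variables. -/
def sndIx : Fin 6 → Fin 4 := ![1, 3, 2, 3, 3, 2]

/-- The product of the `p`-th pair of variables. -/
noncomputable def pairMon (p : Fin 6) : Poly 4 := X (fstIx p) * X (sndIx p)

/-- The monomial attached to a list of pairs of variables. -/
noncomputable def word : List (Fin 6) → Poly 4
  | [] => 1
  | p :: l => pairMon p * word l ^ 2

/-- Prefixing a polynomial by a list of pairs of variables. -/
noncomputable def pre (f : Poly 4) : List (Fin 6) → Poly 4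
  | [] => f
  | p :: l => pairMon p * pre f l ^ 2

theorem word_append (l l' : List (Fin 6)) : word (l ++ l') = pre (word l') l := by
  induction l with
  | nil => rfl
  | cons p l ih => rw [List.cons_append, word, ih, pre]

theorem pre_add (f g : Poly 4) (l : List (Fin 6)) : pre (f + g) l = pre f l + pre g l := by
  induction l with
  | nil => rfl
  | cons p l ih => rw [pre, ih, add_pow_char, mul_add]; rfl

theorem pre_mem_hit {f : Poly 4} (hf : f ∈ hitSubmodule 4) (l : List (Fin 6)) :
    pre f l ∈ hitSubmodule 4 := by
  induction l with
  | nil => exact hf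
  | cons p l ih => exact X_mul_X_mul_hit_sq_mem_hit _ _ ih

theorem isHomogeneous_pairMon (p : Fin 6) : (pairMon p).IsHomogeneous 2 :=
  (isHomogeneous_X _ _).mul (isHomogeneous_X _ _)

theorem isHomogeneous_word (l : List (Fin 6)) :
    (word l).IsHomogeneous (2 ^ (l.length + 1) - 2) := by
  induction l with
  | nil => exact isHomogeneous_one _ _
  | cons p l ih =>
    have := (isHomogeneous_pairMon p).mul (ih.pow 2)
    rw [List.length_cons, pow_succ]
    have h : 2 ^ 1 ≤ 2 ^ (l.length + 1) := Nat.pow_le_pow_right (by norm_num) (by omega)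
    rwa [show 2 + (2 ^ (l.length + 1) - 2) * 2 = 2 ^ (l.length + 1) * 2 - 2 by omega] at this

theorem word_perm {l l' : List (Fin 6)} (h : l.Perm l') : word l + word l' ∈ hitSubmodule 4 := by
  induction h with
  | nil => rw [CharTwo.add_self_eq_zero]; exact zero_mem _
  | cons p _ ih =>
    have := X_mul_X_mul_hit_sq_mem_hit (fstIx p) (sndIx p) ih
    rwa [add_pow_char, mul_add] at this
  | swap p q l => exact swap_mem_hit _ _ _ _ _
  | @trans l₁ l₂ l₃ _ _ h₁ h₂ =>
    have := add_mem h₁ h₂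
    rwa [show word l₁ + word l₂ + (word l₂ + word l₃) = word l₁ + word l₃ + (word l₂ + word l₂) by
      ring, CharTwo.add_self_eq_zero, add_zero] at this

/-- The pair of variables complementary to the `p`-th one. -/
def opp : Fin 6 → Fin 6 := ![1, 0, 3, 2, 5, 4]

theorem exists_pairMon_of_overlap {p q : Fin 6} (h : q ≠ opp p) :
    ∃ r a b : Fin 4, pairMon p = X r * X a ∧ pairMon q = X r * X b := by
  have key : ∀ p q : Fin 6, q ≠ opp p → ∃ r a b : Fin 4,
      ((fstIx p = r ∧ sndIx p = a) ∨ (fstIx p = a ∧ sndIx p = r)) ∧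
      ((fstIx q = r ∧ sndIx q = b) ∨ (fstIx q = b ∧ sndIx q = r)) := by decide
  obtain ⟨r, a, b, h1, h2⟩ := key p q h
  refine ⟨r, a, b, ?_, ?_⟩
  · rcases h1 with ⟨h1, h1'⟩ | ⟨h1, h1'⟩ <;> rw [pairMon, h1, h1']
    exact mul_comm _ _
  · rcases h2 with ⟨h2, h2'⟩ | ⟨h2, h2'⟩ <;> rw [pairMon, h2, h2']
    exact mul_comm _ _

theorem word_overlap {p q : Fin 6} (h : q ≠ opp p) (l : List (Fin 6)) :
    word (p :: p :: q :: l) + word (p :: q :: q :: l) ∈ hitSubmodule 4 := by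
  obtain ⟨r, a, b, hp, hq⟩ := exists_pairMon_of_overlap h
  simp only [word, hp, hq]
  exact overlap_mem_hit r a b _

theorem word_plucker (l : List (Fin 6)) :
    word (0 :: 1 :: l) + word (2 :: 3 :: l) + word (4 :: 5 :: l) ∈ hitSubmodule 4 :=
  three_term_mem_hit 0 1 2 3 _

/-- The polynomial measuring the failure of the exchange relation in degree `14`. -/
noncomputable def defect : Poly 4 := word [0, 0, 1] + word [0, 1, 1]

theorem word_cubic₀ : word [0, 1, 1] + word [2, 2, 3] + word [4, 4, 5] ∈ hitSubmodule 4 :=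
  cubic_relation_mem_hit 0 1 2 3

theorem word_cubic₁ : word [2, 3, 3] + word [0, 0, 1] + word [4, 4, 5] ∈ hitSubmodule 4 := by
  have := cubic_relation_mem_hit (k := 4) 0 2 1 3
  rwa [mul_comm (X 2) (X 1)] at this

theorem word_cubic₂ : word [4, 5, 5] + word [0, 0, 1] + word [2, 2, 3] ∈ hitSubmodule 4 := by
  have := cubic_relation_mem_hit (k := 4) 0 3 1 2
  rwa [mul_comm (X 3) (X 2), mul_comm (X 3) (X 1)] at this

theorem word_defect (p : Fin 6) :
    word [p, p, opp p] + word [p, opp p, opp p] + defect ∈ hitSubmodule 4 := by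
  have hz : ∀ f : Poly 4, f + f = 0 := CharTwo.add_self_eq_zero
  have symm : ∀ q r : Fin 6, word [q, q, r] + word [q, r, r] + defect ∈ hitSubmodule 4 →
      word [r, r, q] + word [r, q, q] + defect ∈ hitSubmodule 4 := by
    intro q r h
    have h1 := word_perm (show [r, r, q].Perm [q, r, r] from
      (List.perm_append_comm : ([r, r] ++ [q]).Perm ([q] ++ [r, r])))
    have h2 := word_perm (show [r, q, q].Perm [q, q, r] from
      (List.perm_append_comm : ([r] ++ [q, q]).Perm ([q, q] ++ [r])))
    convert add_mem h (add_mem h1 h2) using 1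
    linear_combination (-hz (word [q, r, r])) - hz (word [q, q, r])
  have h0 : word [0, 0, 1] + word [0, 1, 1] + defect ∈ hitSubmodule 4 := by
    rw [defect, hz]; exact zero_mem _
  have h2 : word [2, 2, 3] + word [2, 3, 3] + defect ∈ hitSubmodule 4 := by
    convert add_mem word_cubic₀ word_cubic₁ using 1
    rw [defect]
    linear_combination -hz (word [4, 4, 5])
  have h4 : word [4, 4, 5] + word [4, 5, 5] + defect ∈ hitSubmodule 4 := by
    convert add_mem word_cubic₀ word_cubic₂ using 1
    rw [defect]
    linear_combination -hz (word [2, 2, 3])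
  fin_cases p
  · exact h0
  · exact symm _ _ h0
  · exact h2
  · exact symm _ _ h2
  · exact h4
  · exact symm _ _ h4

theorem word_exchange {p q x : Fin 6} (hpq : p ≠ q) (l : List (Fin 6)) :
    word (p :: p :: q :: x :: l) + word (p :: q :: q :: x :: l) ∈ hitSubmodule 4 := by
  have perm : ∀ {l l' : List (Fin 6)}, l.Perm l' →
      (hitSubmodule 4).mkQ (word l) = (hitSubmodule 4).mkQ (word l') := fun h =>
    mkQ_eq_mkQ.2 (word_perm h)
  have ovl : ∀ {p q : Fin 6} (l : List (Fin 6)), q ≠ opp p →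
      (hitSubmodule 4).mkQ (word (p :: p :: q :: l)) =
        (hitSubmodule 4).mkQ (word (p :: q :: q :: l)) := fun l h =>
    mkQ_eq_mkQ.2 (word_overlap h l)
  have opp_inj : ∀ a b : Fin 6, a = opp b ↔ b = opp a := by decide
  have disj : ∀ {p x : Fin 6}, x ≠ p → x ≠ opp p →
      word (p :: p :: opp p :: x :: l) + word (p :: opp p :: opp p :: x :: l) ∈
        hitSubmodule 4 := by
    intro p x h1 h2
    have e1 : p ≠ opp x := fun h => h2 ((opp_inj _ _).1 h)
    have e2 : opp p ≠ opp x := by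
      have : ∀ p x : Fin 6, x ≠ p → opp p ≠ opp x := by decide
      exact this p x h1
    rw [← mkQ_eq_mkQ]
    have q1 : (p :: p :: opp p :: x :: l).Perm (x :: p :: p :: opp p :: l) := by
      rw [List.perm_iff_count]; intro a; simp only [List.count_cons]; ring
    have q2 : (x :: x :: p :: opp p :: l).Perm (x :: x :: opp p :: p :: l) := by
      rw [List.perm_iff_count]; intro a; simp only [List.count_cons]; ring
    have q3 : (p :: opp p :: opp p :: x :: l).Perm (x :: opp p :: opp p :: p :: l) := by
      rw [List.perm_iff_count]; intro a; simp only [List.count_cons]; ring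
    rw [perm q1, ← ovl _ e1, perm q2, ovl _ e2, perm q3]
  by_cases hq : q = opp p
  · subst hq
    by_cases hx : x ≠ p ∧ x ≠ opp p
    · exact disj hx.1 hx.2
    · have key : ∀ p x : Fin 6, ¬ (x ≠ p ∧ x ≠ opp p) → ∃ b, x ≠ b ∧ x ≠ opp b := by decide
      obtain ⟨b, hb1, hb2⟩ := key p x hx
      have h := pre_mem_hit (add_mem (word_defect p) (word_defect b)) (x :: l)
      simp only [pre_add, ← word_append] at h
      have perm' : ∀ u v w : Fin 6, (x :: l ++ [u, v, w]).Perm (u :: v :: w :: x :: l) :=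
        fun u v w => List.perm_append_comm
      have hd := mkQ_eq_mkQ.2 (disj hb1 hb2)
      rw [← mkQ_eq_mkQ]
      rw [← (hitSubmodule 4).ker_mkQ, LinearMap.mem_ker] at h
      simp only [map_add, perm (perm' _ _ _)] at h
      rw [hd, ZModModule.add_self, zero_add, add_assoc, ZModModule.add_self, add_zero] at h
      rwa [← sub_eq_zero, ZModModule.sub_eq_add]
  · exact word_overlap hq _

theorem isHomogeneous_monomial_one {k : ℕ} (a : Fin k →₀ ℕ) :
    (monomial a 1 : Poly k).IsHomogeneous a.degree :=
  isHomogeneous_monomial _ rfl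

/-- An additive map sends homogeneous polynomials into a submodule as soon as it does so
for monomials. -/
theorem map_homogeneous_mem {k n : ℕ} {N : Submodule (ZMod 2) (Poly k)} (φ : Poly k → Poly k)
    (h0 : φ 0 = 0) (hadd : ∀ f g, φ (f + g) = φ f + φ g)
    (hm : ∀ a : Fin k →₀ ℕ, a.degree = n → φ (monomial a 1) ∈ N)
    {f : Poly k} (hf : f.IsHomogeneous n) : φ f ∈ N := by
  classical
  have key : ∀ s : Finset (Fin k →₀ ℕ), (∀ a ∈ s, a.degree = n) →
      φ (∑ a ∈ s, monomial a 1) ∈ N := by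
    intro s
    induction s using Finset.induction_on with
    | empty => intro _; rw [Finset.sum_empty, h0]; exact zero_mem _
    | insert a s ha ih =>
      intro hs
      rw [Finset.sum_insert ha, hadd]
      exact add_mem (hm a (hs a (Finset.mem_insert_self _ _)))
        (ih fun b hb => hs b (Finset.mem_insert_of_mem hb))
  have h1 : f = ∑ a ∈ f.support, monomial a 1 := by
    conv_lhs => rw [f.as_sum]
    refine Finset.sum_congr rfl fun a ha => ?_
    have : coeff a f ≠ 0 := mem_support_iff.1 ha
    congr 1
    revert this; generalize coeff a f = c; revert c; decide
  rw [h1]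
  exact key _ fun a ha => (hf.degree_eq_sum_deg_support ha).symm ▸ rfl

/-- Every monomial is a squarefree monomial times a square. -/
theorem exists_monomial_eq {k : ℕ} (a : Fin k →₀ ℕ) :
    ∃ (Y : Finset (Fin k)) (b : Fin k →₀ ℕ),
      (monomial a 1 : Poly k) = (∏ i ∈ Y, X i) * monomial b 1 ^ 2 ∧
        a.degree = Y.card + 2 * b.degree := by
  classical
  let b : Fin k →₀ ℕ := Finsupp.equivFunOnFinite.symm fun i => a i / 2
  let Y : Finset (Fin k) := Finset.univ.filter fun i => a i % 2 = 1
  have hprod : ∀ c : Fin k →₀ ℕ, (monomial c 1 : Poly k) = ∏ i, X i ^ c i := by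
    intro c
    rw [monomial_eq, Finsupp.prod_fintype _ _ fun i => pow_zero _, C_1, one_mul]
  have hY : (∏ i ∈ Y, X i : Poly k) = ∏ i, X i ^ (a i % 2) := by
    rw [Finset.prod_filter]
    refine Finset.prod_congr rfl fun i _ => ?_
    rcases Nat.mod_two_eq_zero_or_one (a i) with h | h <;> simp [h]
  refine ⟨Y, b, ?_, ?_⟩
  · rw [hY, hprod, hprod, ← Finset.prod_pow, ← Finset.prod_mul_distrib]
    refine Finset.prod_congr rfl fun i _ => ?_
    rw [← pow_mul, ← pow_add]
    congr 1
    simp only [b, Finsupp.equivFunOnFinite_symm_apply_apply]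
    omega
  · rw [Finset.card_filter, Finsupp.degree_eq_sum, Finsupp.degree_eq_sum, Finset.mul_sum,
      ← Finset.sum_add_distrib]
    refine Finset.sum_congr rfl fun i _ => ?_
    simp only [b, Finsupp.equivFunOnFinite_symm_apply_apply]
    split_ifs <;> omega

/-- The span of the words of length `s` and of the hit polynomials. -/
noncomputable def wordSpan (s : ℕ) : Submodule (ZMod 2) (Poly 4) :=
  Submodule.span (ZMod 2) {f | ∃ l : List (Fin 6), l.length = s ∧ f = word l} ⊔ hitSubmodule 4

theorem hit_le_wordSpan (s : ℕ) : hitSubmodule 4 ≤ wordSpan s := le_sup_right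

theorem word_mem_wordSpan (l : List (Fin 6)) : word l ∈ wordSpan l.length :=
  Submodule.mem_sup_left (Submodule.subset_span ⟨l, rfl, rfl⟩)

theorem span_map_mem {k : ℕ} {S : Set (Poly k)} {N : Submodule (ZMod 2) (Poly k)}
    (φ : Poly k → Poly k) (h0 : φ 0 = 0) (hadd : ∀ f g, φ (f + g) = φ f + φ g)
    (hS : ∀ f ∈ S, φ f ∈ N) {f : Poly k} (hf : f ∈ Submodule.span (ZMod 2) S) : φ f ∈ N := by
  induction hf using Submodule.span_induction with
  | mem x hx => exact hS x hx
  | zero => rw [h0]; exact zero_mem _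
  | add x y _ _ hx hy => rw [hadd]; exact add_mem hx hy
  | smul a x _ hx =>
    have ha : a = 0 ∨ a = 1 := by revert a; decide
    rcases ha with rfl | rfl
    · rw [zero_smul, h0]; exact zero_mem _
    · rwa [one_smul]

theorem pairMon_mul_sq_mem_wordSpan (p : Fin 6) {s : ℕ} {f : Poly 4} (hf : f ∈ wordSpan s) :
    pairMon p * f ^ 2 ∈ wordSpan (s + 1) := by
  obtain ⟨g, hg, h, hh, rfl⟩ := Submodule.mem_sup.1 hf
  rw [add_pow_char, mul_add]
  refine add_mem (span_map_mem (fun f => pairMon p * f ^ 2) (by simp)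
    (fun f g => by simp only [add_pow_char]; ring) ?_ hg)
    (hit_le_wordSpan _ (X_mul_X_mul_hit_sq_mem_hit _ _ hh))
  rintro _ ⟨l, rfl, rfl⟩
  exact word_mem_wordSpan (p :: l)

theorem exists_pairMon_eq {i j : Fin 4} (h : i ≠ j) : ∃ p, X i * X j = pairMon p := by
  have key : ∀ i j : Fin 4, i ≠ j → ∃ p, (fstIx p = i ∧ sndIx p = j) ∨
      (fstIx p = j ∧ sndIx p = i) := by decide
  obtain ⟨p, ⟨h1, h2⟩ | ⟨h1, h2⟩⟩ := key i j h
  · exact ⟨p, by rw [pairMon, h1, h2]⟩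
  · exact ⟨p, by rw [pairMon, h1, h2, mul_comm]⟩

theorem prod_eq_pairMon_mul (p : Fin 6) :
    (∏ i : Fin 4, X i : Poly 4) = pairMon p * pairMon (opp p) := by
  rw [Fin.prod_univ_four]
  fin_cases p <;> simp [pairMon, fstIx, sndIx, opp] <;> ring

theorem four_mul_mem_wordSpan {s : ℕ} (ih : ∀ i j : Fin 4, i ≠ j → ∀ z : Poly 4,
    z.IsHomogeneous (2 ^ (s + 1) - 2) → X i * X j * z ^ 2 ∈ wordSpan (s + 1)) (p : Fin 6)
    {g : Poly 4} (hg : g.IsHomogeneous (2 ^ (s + 1) - 3)) (h3 : 3 ≤ 2 ^ (s + 1)) :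
    pairMon p * ((∏ i : Fin 4, X i) * g ^ 2) ^ 2 ∈ wordSpan (s + 2) := by
  have h : pairMon p * ((∏ i : Fin 4, X i) * g ^ 2) ^ 2 =
      sq 1 (X (fstIx p) ^ 3 * X (sndIx p) ^ 3 * X (fstIx (opp p)) * X (sndIx (opp p)) ^ 2 *
        g ^ 4) +
      (X (sndIx p) * X (fstIx (opp p)) *
        (X (sndIx p) * X (sndIx (opp p)) * (X (fstIx p) * g) ^ 2) ^ 2 +
      X (fstIx p) * X (fstIx (opp p)) *
        (X (fstIx p) * X (sndIx (opp p)) * (X (sndIx p) * g) ^ 2) ^ 2) := by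
    rw [prod_eq_pairMon_mul p]
    simp only [sq_one_mul, sq_one_X, sq_one_pow_four, sq_one_X_pow, sq_one_sq, pairMon]
    norm_num
    have := two_eq_zero 4
    grind
  have hne : ∀ p : Fin 6, sndIx p ≠ fstIx (opp p) ∧ sndIx p ≠ sndIx (opp p) ∧
      fstIx p ≠ fstIx (opp p) ∧ fstIx p ≠ sndIx (opp p) := by decide
  have hd : ∀ i : Fin 4, (X i * g).IsHomogeneous (2 ^ (s + 1) - 2) := by
    intro i
    have := (isHomogeneous_X (ZMod 2) i).mul hg
    rwa [show 1 + (2 ^ (s + 1) - 3) = 2 ^ (s + 1) - 2 by omega] at this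
  have hp : ∀ i j : Fin 4, i ≠ j → ∀ f ∈ wordSpan (s + 1),
      X i * X j * f ^ 2 ∈ wordSpan (s + 2) := by
    intro i j hij f hf
    obtain ⟨q, hq⟩ := exists_pairMon_eq hij
    rw [hq]
    exact pairMon_mul_sq_mem_wordSpan q hf
  obtain ⟨n1, n2, n3, n4⟩ := hne p
  rw [h]
  exact add_mem (hit_le_wordSpan _ (sq_mem_hit one_pos _))
    (add_mem (hp _ _ n1 _ (ih _ _ n2 _ (hd _))) (hp _ _ n3 _ (ih _ _ n4 _ (hd _))))

theorem pair_mul_sq_mem_wordSpan (s : ℕ) : ∀ i j : Fin 4, i ≠ j → ∀ z : Poly 4,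
    z.IsHomogeneous (2 ^ (s + 1) - 2) → X i * X j * z ^ 2 ∈ wordSpan (s + 1) := by
  induction s with
  | zero =>
    intro i j hij z hz
    refine map_homogeneous_mem (fun z => X i * X j * z ^ 2) (by simp)
      (fun f g => by simp only [add_pow_char]; ring) (fun a ha => ?_) hz
    obtain ⟨p, hp⟩ := exists_pairMon_eq hij
    rw [(Finsupp.degree_eq_zero_iff a).1 (by simpa using ha)]
    simp only [hp]
    exact word_mem_wordSpan [p]
  | succ s ih =>
    intro i j hij z hz
    refine map_homogeneous_mem (fun z => X i * X j * z ^ 2) (by simp)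
      (fun f g => by simp only [add_pow_char]; ring) (fun a ha => ?_) hz
    obtain ⟨p, hp⟩ := exists_pairMon_eq hij
    obtain ⟨Y, b, hab, hd⟩ := exists_monomial_eq a
    simp only [hp]
    have h2 : 2 ^ 1 ≤ 2 ^ (s + 1) := Nat.pow_le_pow_right (by norm_num) (by omega)
    have h4 : Y.card ≤ 4 := by simpa using Y.card_le_univ
    rw [ha, pow_succ] at hd
    have hY : Y.card = 0 ∨ Y.card = 2 ∨ Y.card = 4 := by omega
    rcases hY with hY | hY | hY
    · rw [Finset.card_eq_zero] at hY
      subst hY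
      rw [Finset.prod_empty, one_mul] at hab
      rw [hab]
      refine hit_le_wordSpan _ (X_mul_X_mul_hit_sq_mem_hit _ _
        (sq_mem_hit_of_isHomogeneous (isHomogeneous_monomial_one b) ?_))
      rw [Finset.card_empty] at hd
      omega
    · obtain ⟨c, d, hcd, rfl⟩ := Finset.card_eq_two.1 hY
      rw [Finset.prod_pair hcd] at hab
      rw [hab]
      refine pairMon_mul_sq_mem_wordSpan p (ih c d hcd _ ?_)
      rw [show 2 ^ (s + 1) - 2 = b.degree by omega]
      exact isHomogeneous_monomial_one b
    · have hu : Y = Finset.univ := Finset.eq_univ_of_card Y (by simpa using hY)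
      subst hu
      rw [hab]
      refine four_mul_mem_wordSpan ih p ?_ (by omega)
      rw [show 2 ^ (s + 1) - 3 = b.degree by omega]
      exact isHomogeneous_monomial_one b

/-- The product of all variables but the `p`-th one. -/
noncomputable def triMon (p : Fin 4) : Poly 4 :=
  X (p.succAbove 0) * X (p.succAbove 1) * X (p.succAbove 2)

/-- The monomial of odd degree attached to a list of triples of variables and a variable. -/
noncomputable def bword : List (Fin 4) → Fin 4 → Poly 4
  | [], i => X i
  | p :: l, i => triMon p * bword l i ^ 2

theorem exists_triMon_eq {p q : Fin 4} (h : p ≠ q) :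
    ∃ r r' : Fin 4, triMon p = X r * X r' * X q ∧ triMon q = X r * X r' * X p := by
  have key : ∀ p q : Fin 4, p ≠ q → ∃ r r' : Fin 4,
      ({p.succAbove 0, p.succAbove 1, p.succAbove 2} : Multiset (Fin 4)) = {r, r', q} ∧
      ({q.succAbove 0, q.succAbove 1, q.succAbove 2} : Multiset (Fin 4)) = {r, r', p} := by
    decide
  obtain ⟨r, r', h1, h2⟩ := key p q h
  refine ⟨r, r', ?_, ?_⟩
  · simpa [triMon, mul_assoc] using
      congrArg (fun m : Multiset (Fin 4) => (m.map (X : _ → Poly 4)).prod) h1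
  · simpa [triMon, mul_assoc] using
      congrArg (fun m : Multiset (Fin 4) => (m.map (X : _ → Poly 4)).prod) h2

theorem triMon_mul_X (p : Fin 4) : triMon p * X p = X 0 * X 1 * X 2 * X 3 := by
  have := Fin.prod_univ_succAbove (fun i => (X i : Poly 4)) p
  rw [Fin.prod_univ_four, Fin.prod_univ_three] at this
  rw [this, triMon]
  ring

theorem isHomogeneous_triMon (p : Fin 4) : (triMon p).IsHomogeneous 3 :=
  ((isHomogeneous_X _ _).mul (isHomogeneous_X _ _)).mul (isHomogeneous_X _ _)

theorem four_le_two_pow (n : ℕ) : 2 ^ 2 ≤ 2 ^ (n + 2) :=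
  Nat.pow_le_pow_right (by norm_num) (by omega)

theorem odd_two_pow_sub_three (n : ℕ) : Odd (2 ^ (n + 2) - 3) := by
  have h := four_le_two_pow n
  rw [pow_add] at h ⊢
  exact ⟨2 ^ n * 2 - 2, by omega⟩

theorem isHomogeneous_triMon_mul_sq (p : Fin 4) {n : ℕ} {f : Poly 4}
    (hf : f.IsHomogeneous (2 ^ (n + 2) - 3)) :
    (triMon p * f ^ 2).IsHomogeneous (2 ^ (n + 1 + 2) - 3) := by
  have := (isHomogeneous_triMon p).mul (hf.pow 2)
  have h := four_le_two_pow n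
  rw [show n + 1 + 2 = n + 2 + 1 by ring, pow_succ]
  rwa [show 3 + (2 ^ (n + 2) - 3) * 2 = 2 ^ (n + 2) * 2 - 3 by omega] at this

theorem isHomogeneous_bword (l : List (Fin 4)) (i : Fin 4) :
    (bword l i).IsHomogeneous (2 ^ (l.length + 2) - 3) := by
  induction l with
  | nil => exact isHomogeneous_X _ _
  | cons p l ih => exact isHomogeneous_triMon_mul_sq p ih

theorem triMon_mul_sq_mem_hit (p : Fin 4) {n : ℕ} {f : Poly 4} (hf : f ∈ hitSubmodule 4)
    (hn : f.IsHomogeneous (2 ^ (n + 2) - 3)) : triMon p * f ^ 2 ∈ hitSubmodule 4 :=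
  X_mul_X_mul_X_mul_hit_sq_mem_hit _ _ _ hf hn (odd_two_pow_sub_three n)

theorem bword_perm {l l' : List (Fin 4)} (h : l.Perm l') (i : Fin 4) :
    bword l i + bword l' i ∈ hitSubmodule 4 := by
  induction h with
  | nil => rw [CharTwo.add_self_eq_zero]; exact zero_mem _
  | @cons p l l' h ih =>
    have := triMon_mul_sq_mem_hit p ih
      ((isHomogeneous_bword l i).add (h.length_eq ▸ isHomogeneous_bword l' i))
    rwa [add_pow_char, mul_add] at this
  | swap p q l =>
    by_cases hpq : q = p
    · rw [hpq, CharTwo.add_self_eq_zero]; exact zero_mem _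
    · obtain ⟨r, r', h1, h2⟩ := exists_triMon_eq hpq
      simp only [bword, h1, h2]
      exact odd_swap_mem_hit _ _ _ _ (isHomogeneous_bword l i) (odd_two_pow_sub_three _)
  | @trans l₁ l₂ l₃ _ _ h₁ h₂ =>
    have := add_mem h₁ h₂
    rwa [show bword l₁ i + bword l₂ i + (bword l₂ i + bword l₃ i) =
      bword l₁ i + bword l₃ i + (bword l₂ i + bword l₂ i) by
      ring, CharTwo.add_self_eq_zero, add_zero] at this

theorem bword_exchange {p q : Fin 4} (hpq : p ≠ q) (l : List (Fin 4)) (i : Fin 4) :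
    bword (p :: p :: q :: l) i + bword (p :: q :: q :: l) i ∈ hitSubmodule 4 := by
  obtain ⟨r, r', h1, h2⟩ := exists_triMon_eq hpq
  simp only [bword, h1, h2]
  exact odd_exchange_mem_hit _ _ _ _ (isHomogeneous_bword l i) (odd_two_pow_sub_three _)

theorem sum_bword_append_mem_hit (l : List (Fin 4)) :
    ∑ i, bword (l ++ [i]) i ∈ hitSubmodule 4 := by
  induction l with
  | nil =>
    have h : ∑ i, bword ([] ++ [i]) i = sq 1 (X 0 * X 1 * X 2 * X 3) := by
      have h1 : ∀ i, bword ([] ++ [i]) i = X 0 * X 1 * X 2 * X 3 * X i := fun i => by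
        rw [← triMon_mul_X i]; simp only [List.nil_append, bword]; ring
      simp only [h1, Fin.sum_univ_four, sq_one_mul, sq_one_X]
      ring
    exact h ▸ sq_mem_hit one_pos _
  | cons p l ih =>
    have := triMon_mul_sq_mem_hit p ih (n := l.length + 1) (IsHomogeneous.sum _ _ _ fun i _ => by
      simpa using isHomogeneous_bword (l ++ [i]) i)
    rwa [sum_pow_char, Finset.mul_sum] at this

theorem sum_bword_cons_mem_hit (l : List (Fin 4)) :
    ∑ i, bword (i :: l) i ∈ hitSubmodule 4 := by
  have h := add_mem (sum_bword_append_mem_hit l) (sum_mem fun i (_ : i ∈ Finset.univ) =>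
    bword_perm (List.perm_append_comm : (l ++ [i]).Perm ([i] ++ l)) i)
  rwa [Finset.sum_add_distrib, ← add_assoc, CharTwo.add_self_eq_zero, zero_add] at h

theorem bword_replicate (n : ℕ) (i : Fin 4) :
    bword (List.replicate n i) i = X i * (X 0 * X 1 * X 2 * X 3) ^ (2 ^ n - 1) := by
  induction n with
  | zero => simp [bword]
  | succ n ih =>
    have h : 1 ≤ 2 ^ n := Nat.one_le_two_pow
    rw [List.replicate_succ, bword, ih, pow_succ 2 n,
      show 2 ^ n * 2 - 1 = (2 ^ n - 1) * 2 + 1 by omega, pow_succ _ ((2 ^ n - 1) * 2), pow_mul]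
    nth_rw 3 [← triMon_mul_X i]
    ring

theorem sum_bword_replicate_mem_hit (n : ℕ) :
    ∑ i, bword (List.replicate (n + 1) i) i ∈ hitSubmodule 4 := by
  have hc : ((2 ^ (n + 1) - 1 : ℕ) : Poly 4) = 1 := by
    have h : 2 ^ (n + 1) - 1 = 2 * (2 ^ n - 1) + 1 := by
      have : 1 ≤ 2 ^ n := Nat.one_le_two_pow
      rw [pow_succ]; omega
    rw [h]
    push_cast
    rw [two_eq_zero, zero_mul, zero_add]
  have h : ∑ i, bword (List.replicate (n + 1) i) i =
      sq 1 ((X 0 * X 1 * X 2 * X 3) ^ (2 ^ (n + 1) - 1)) := by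
    simp only [bword_replicate, mul_pow, sq_one_mul, sq_one_X_pow, hc, Fin.sum_univ_four]
    ring
  exact h ▸ sq_mem_hit one_pos _

theorem triMon_mul_sq_mem_sup (p : Fin 4) {n : ℕ} {V : Submodule (ZMod 2) (Poly 4)}
    (hV : ∀ f ∈ V, f.IsHomogeneous (2 ^ (n + 2) - 3))
    {f : Poly 4} (hn : f.IsHomogeneous (2 ^ (n + 2) - 3)) (hf : f ∈ V ⊔ hitSubmodule 4)
    {N : Submodule (ZMod 2) (Poly 4)} (hN : ∀ f ∈ V, triMon p * f ^ 2 ∈ N) :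
    triMon p * f ^ 2 ∈ N ⊔ hitSubmodule 4 := by
  obtain ⟨g, hg, h, hh, rfl⟩ := Submodule.mem_sup.1 hf
  have hdeg : h.IsHomogeneous (2 ^ (n + 2) - 3) := by
    have := hn.sub (hV g hg)
    rwa [add_sub_cancel_left] at this
  rw [add_pow_char, mul_add]
  exact add_mem (Submodule.mem_sup_left (hN g hg))
    (Submodule.mem_sup_right (triMon_mul_sq_mem_hit p hh hdeg))

/-- The span of the odd words of length `n`. -/
noncomputable def bwordSpan (n : ℕ) : Submodule (ZMod 2) (Poly 4) :=
  Submodule.span (ZMod 2) {f | ∃ (l : List (Fin 4)) (i : Fin 4), l.length = n ∧ f = bword l i}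

theorem isHomogeneous_of_mem_bwordSpan {n : ℕ} {f : Poly 4} (hf : f ∈ bwordSpan n) :
    f.IsHomogeneous (2 ^ (n + 2) - 3) := by
  rw [← mem_homogeneousSubmodule]
  refine (Submodule.span_le.2 ?_ : bwordSpan n ≤ _) hf
  rintro _ ⟨l, i, rfl, rfl⟩
  exact isHomogeneous_bword l i

theorem mem_bwordSpan_sup_hit (n : ℕ) : ∀ f : Poly 4, f.IsHomogeneous (2 ^ (n + 2) - 3) →
    f ∈ bwordSpan n ⊔ hitSubmodule 4 := by
  induction n with
  | zero =>
    intro f hf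
    refine map_homogeneous_mem (fun z => z) rfl (fun _ _ => rfl) (fun a ha => ?_) hf
    obtain ⟨Y, b, hab, hd⟩ := exists_monomial_eq a
    obtain ⟨i, rfl⟩ := Finset.card_eq_one.1 (show Y.card = 1 by norm_num at ha; omega)
    rw [Finset.card_singleton] at hd
    rw [(Finsupp.degree_eq_zero_iff b).1 (by norm_num at ha; omega), Finset.prod_singleton] at hab
    rw [hab]
    refine Submodule.mem_sup_left (Submodule.subset_span ⟨[], i, rfl, ?_⟩)
    simp [bword]
  | succ n ih =>
    intro f hf
    refine map_homogeneous_mem (fun z => z) rfl (fun _ _ => rfl) (fun a ha => ?_) hf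
    obtain ⟨Y, b, hab, hd⟩ := exists_monomial_eq a
    have h2 := four_le_two_pow n
    have h4 : Y.card ≤ 4 := by simpa using Y.card_le_univ
    rw [ha, show n + 1 + 2 = n + 2 + 1 by ring, pow_succ] at hd
    have hY : Y.card = 1 ∨ Y.card = 3 := by omega
    rcases hY with hY | hY
    · obtain ⟨i, rfl⟩ := Finset.card_eq_one.1 hY
      rw [Finset.prod_singleton] at hab
      rw [hab]
      refine Submodule.mem_sup_right (X_mul_even_sq_mem_hit i (isHomogeneous_monomial_one b)
        ?_ (by omega))
      rw [show b.degree = 2 ^ (n + 2) - 2 by omega, pow_succ]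
      exact ⟨2 ^ (n + 1) - 1, by omega⟩
    · have key : ∀ Y : Finset (Fin 4), Y.card = 3 →
          ∃ p : Fin 4, Y.val = {p.succAbove 0, p.succAbove 1, p.succAbove 2} := by decide
      obtain ⟨p, hp⟩ := key Y hY
      have hprod : (∏ i ∈ Y, X i : Poly 4) = triMon p := by
        rw [Finset.prod, hp]
        simp [triMon, mul_assoc]
      rw [hab, hprod]
      have hb : (monomial b 1 : Poly 4).IsHomogeneous (2 ^ (n + 2) - 3) := by
        rw [show 2 ^ (n + 2) - 3 = b.degree by omega]
        exact isHomogeneous_monomial_one b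
      refine triMon_mul_sq_mem_sup p (fun f hf => isHomogeneous_of_mem_bwordSpan hf) hb (ih _ hb)
        fun f hf => span_map_mem (fun f => triMon p * f ^ 2) (by simp)
          (fun f g => by simp only [add_pow_char]; ring) ?_ hf
      rintro _ ⟨l, i, rfl, rfl⟩
      exact Submodule.subset_span ⟨p :: l, i, rfl, rfl⟩

/-- The sum of the values of `k` at the positions of the nonzero binary digits of `m` below `n`. -/
def bitSum {M : Type*} [AddCommMonoid M] (n : ℕ) (k : ℕ → M) (m : ℕ) : M :=
  ∑ j ∈ Finset.range n, if m.testBit j then k j else 0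

theorem bitSum_xor {M : Type*} [AddCommGroup M] [Module (ZMod 2) M] (n : ℕ) (k : ℕ → M)
    (a b : ℕ) : bitSum n k (a ^^^ b) = bitSum n k a + bitSum n k b := by
  rw [bitSum, bitSum, bitSum, ← Finset.sum_add_distrib]
  refine Finset.sum_congr rfl fun j _ => ?_
  rw [Nat.testBit_xor]
  cases a.testBit j <;> cases b.testBit j <;> simp [ZModModule.add_self]

theorem bitSum_one_shiftLeft {M : Type*} [AddCommMonoid M] {n : ℕ} (k : ℕ → M) {m : ℕ}
    (hm : m < n) : bitSum n k (1 <<< m) = k m := by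
  rw [bitSum, Nat.one_shiftLeft]
  simp only [Nat.testBit_two_pow]
  simp [hm]

/-- The combination of the bit masks `r U`, for `U` in a list. -/
def xorMasks (r : ℕ → ℕ) (L : List ℕ) : ℕ := L.foldr (fun U z => r U ^^^ z) 0

theorem bitSum_xorMasks {M : Type*} [AddCommGroup M] [Module (ZMod 2) M] {n : ℕ} {k : ℕ → M}
    {r : ℕ → ℕ} {L : List ℕ} (hL : ∀ U ∈ L, bitSum n k (r U) = 0) :
    bitSum n k (xorMasks r L) = 0 := by
  induction L with
  | nil => simp [xorMasks, bitSum]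
  | cons U L ih =>
    rw [xorMasks, List.foldr_cons, bitSum_xor, hL U (by simp), zero_add]
    exact ih fun U hU => hL U (by simp [hU])

theorem mem_span_of_bitSum_eq_zero {M : Type*} [AddCommGroup M] [Module (ZMod 2) M] {n : ℕ}
    {k : ℕ → M} {r : ℕ → ℕ} {L : List ℕ} (hL : ∀ U ∈ L, bitSum n k (r U) = 0) {V : ℕ} (hV : V < n)
    {S : Set ℕ} (hS : ∀ j < n, ((1 <<< V) ^^^ xorMasks r L).testBit j → j ∈ S) :
    k V ∈ Submodule.span (ZMod 2) (k '' S) := by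
  have h : k V = bitSum n k ((1 <<< V) ^^^ xorMasks r L) := by
    rw [bitSum_xor, bitSum_one_shiftLeft k hV, bitSum_xorMasks hL, add_zero]
  rw [h, bitSum]
  refine sum_mem fun j hj => ?_
  split_ifs with hb
  · exact Submodule.subset_span ⟨j, hS j (Finset.mem_range.1 hj) hb, rfl⟩
  · exact zero_mem _

/-- The positions of the nonzero binary digits of `m` below `n`. -/
def bits (n m : ℕ) : List (Fin n) := (List.finRange n).filter fun i => m.testBit i

/-- The list of length `s` whose set of entries is given by the binary digits of `m`. -/
def padBits (n s m : ℕ) [NeZero n] : List (Fin n) :=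
  bits n m ++ List.replicate (s - (bits n m).length) ((bits n m).headD 0)

theorem length_padBits {n s m : ℕ} [NeZero n] (h : (bits n m).length ≤ s) :
    (padBits n s m).length = s := by
  rw [padBits, List.length_append, List.length_replicate]
  omega

theorem toFinset_padBits {n s m : ℕ} [NeZero n] (h : bits n m ≠ []) :
    (padBits n s m).toFinset = (bits n m).toFinset := by
  ext a
  obtain ⟨b, l, hb⟩ := List.exists_cons_of_ne_nil h
  simp only [padBits, hb, List.mem_toFinset, List.mem_append, List.mem_replicate, List.headD_cons,
    List.mem_cons]
  tauto

theorem nodup_bits (n m : ℕ) : (bits n m).Nodup := (List.nodup_finRange n).filter _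

theorem length_bits_le {n m : ℕ} {l : List (Fin n)} (h : l.toFinset = (bits n m).toFinset) :
    (bits n m).length ≤ l.length := by
  rw [← List.toFinset_card_of_nodup (nodup_bits n m), ← h]
  exact List.toFinset_card_le l

theorem exists_bits_six : ∀ S : Finset (Fin 6), ∃ m < 64, (bits 6 m).toFinset = S := by
  decide +kernel

theorem exists_bits_four : ∀ S : Finset (Fin 4), ∃ m < 16, (bits 4 m).toFinset = S := by
  decide +kernel

/-- The sets of pairs of variables indexing a basis of the words, as bit masks. -/
def stdMasks : List ℕ :=
  [1, 2, 4, 8, 16, 32, 5, 6, 9, 10, 12, 17, 18, 20, 24, 33, 34, 36, 40, 48, 21, 22, 25, 26, 28, 37,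
    38, 41, 42, 44, 49, 50, 52, 56, 60]

/-- The bit mask of the Plücker relation multiplied by the pairs in `U`. -/
def pluckerMask (U : ℕ) : ℕ := (1 <<< (U ||| 3)) ^^^ (1 <<< (U ||| 12)) ^^^ (1 <<< (U ||| 48))

/-- The relations expressing a set of pairs in terms of the standard ones. -/
def pluckerCert (V : ℕ) : List ℕ :=
  (List.lookup V [(3, [0]), (7, [4]), (11, [8]), (13, [0, 1]), (14, [0, 2]), (15, [12]),
    (19, [16]), (23, [20]), (27, [24]), (29, [16, 17]), (30, [16, 18]), (31, [0, 3, 12, 16, 19]),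
    (35, [32]), (39, [36]), (43, [40]), (45, [32, 33]), (46, [32, 34]), (47, [0, 3, 12, 32, 35]),
    (51, [0, 3, 12]), (53, [0, 1, 4, 5]), (54, [0, 2, 4, 6]), (55, [4, 7, 12]),
    (57, [0, 1, 8, 9]), (58, [0, 2, 8, 10]), (59, [8, 11, 12]), (61, [0, 1, 12, 13]),
    (62, [0, 2, 12, 14]), (63, [15])]).getD []

set_option synthInstance.maxHeartbeats 400000 in
set_option synthInstance.maxSize 1000 in
theorem pluckerCert_spec : ∀ V < 64, V ≠ 0 →
    (∀ U ∈ pluckerCert V, U < 64 ∧ (U = 0 ∧ 2 ≤ (bits 6 V).length ∨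
      U ≠ 0 ∧ (bits 6 U).length + 2 ≤ (bits 6 V).length)) ∧
    ∀ j < 64, ((1 <<< V) ^^^ xorMasks pluckerMask (pluckerCert V)).testBit j →
      j ∈ stdMasks ∧ (bits 6 j).length ≤ (bits 6 V).length := by
  decide +kernel

/-- The word of length `s` attached to a bit mask. -/
noncomputable def stdWord (s m : ℕ) : Poly 4 := word (padBits 6 s m)

/-- The exchange property of words of length `s` modulo `N`. -/
def HasExchange (N : Submodule (ZMod 2) (Poly 4)) (s : ℕ) : Prop :=
  hitSubmodule 4 ≤ N ∧ ∀ (p q : Fin 6) (l : List (Fin 6)), p ≠ q → l.length + 3 = s →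
    word (p :: p :: q :: l) + word (p :: q :: q :: l) ∈ N

theorem mkQ_word_eq {N : Submodule (ZMod 2) (Poly 4)} {s : ℕ} (hN : HasExchange N s)
    {l : List (Fin 6)} {m : ℕ} (hl : l.length = s) (hs : s ≠ 0)
    (hm : l.toFinset = (bits 6 m).toFinset) : N.mkQ (word l) = N.mkQ (stdWord s m) := by
  have h0 : bits 6 m ≠ [] := by
    intro h
    rw [h, List.toFinset_nil, List.toFinset_eq_empty_iff] at hm
    exact hs (by rw [← hl, hm, List.length_nil])
  exact eq_of_toFinset_eq (c := fun l => N.mkQ (word l))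
    (fun l l' h => mkQ_eq_mkQ.2 (hN.1 (word_perm h)))
    (fun p q l hpq h => mkQ_eq_mkQ.2 (hN.2 p q l hpq h)) hl
    (length_padBits (hl ▸ length_bits_le hm)) (hm.trans (toFinset_padBits h0).symm)

theorem toFinset_bits_or (U : ℕ) (hU : U < 64) :
    (∀ l : List (Fin 6), l.toFinset = (bits 6 U).toFinset →
      (0 :: 1 :: l).toFinset = (bits 6 (U ||| 3)).toFinset ∧
      (2 :: 3 :: l).toFinset = (bits 6 (U ||| 12)).toFinset ∧
      (4 :: 5 :: l).toFinset = (bits 6 (U ||| 48)).toFinset) ∧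
      U ||| 3 < 64 ∧ U ||| 12 < 64 ∧ U ||| 48 < 64 := by
  have key : ∀ U < 64,
      (insert 0 (insert 1 (bits 6 U).toFinset) = (bits 6 (U ||| 3)).toFinset ∧
      insert 2 (insert 3 (bits 6 U).toFinset) = (bits 6 (U ||| 12)).toFinset ∧
      insert 4 (insert 5 (bits 6 U).toFinset) = (bits 6 (U ||| 48)).toFinset) ∧
      U ||| 3 < 64 ∧ U ||| 12 < 64 ∧ U ||| 48 < 64 := by decide +kernel
  refine ⟨fun l hl => ?_, (key U hU).2⟩
  simp only [List.toFinset_cons, hl]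
  exact (key U hU).1

theorem bitSum_pluckerMask {M : Type*} [AddCommGroup M] [Module (ZMod 2) M] (k : ℕ → M) {U : ℕ}
    (hU : U < 64) :
    bitSum 64 k (pluckerMask U) = k (U ||| 3) + k (U ||| 12) + k (U ||| 48) := by
  obtain ⟨h1, h2, h3⟩ := (toFinset_bits_or U hU).2
  rw [pluckerMask, bitSum_xor, bitSum_xor, bitSum_one_shiftLeft k h1, bitSum_one_shiftLeft k h2,
    bitSum_one_shiftLeft k h3]

theorem bitSum_plucker_eq_zero {N : Submodule (ZMod 2) (Poly 4)} {s : ℕ} (hN : HasExchange N s)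
    {U : ℕ} (hU : U < 64) (h : U ≠ 0 ∧ (bits 6 U).length + 2 ≤ s) :
    bitSum 64 (fun m => N.mkQ (stdWord s m)) (pluckerMask U) = 0 := by
  have h0 : bits 6 U ≠ [] := by
    have key : ∀ U < 64, U ≠ 0 → bits 6 U ≠ [] := by decide +kernel
    exact key U hU h.1
  have hlen : (padBits 6 (s - 2) U).length = s - 2 := length_padBits (by omega)
  obtain ⟨⟨h1, h2, h3⟩, -⟩ :=
    (toFinset_bits_or U hU).imp_left fun f => f _ (toFinset_padBits (s := s - 2) h0)
  rw [bitSum_pluckerMask _ hU,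
    ← mkQ_word_eq hN (by simp only [List.length_cons]; omega) (by omega) h1,
    ← mkQ_word_eq hN (by simp only [List.length_cons]; omega) (by omega) h2,
    ← mkQ_word_eq hN (by simp only [List.length_cons]; omega) (by omega) h3,
    ← map_add, ← map_add, ← LinearMap.mem_ker, N.ker_mkQ]
  exact hN.1 (word_plucker _)

theorem bitSum_plucker_zero_eq_zero {N : Submodule (ZMod 2) (Poly 4)} {s : ℕ}
    (hN : HasExchange N s) (hs : 2 ≤ s) :
    bitSum 64 (fun m => N.mkQ (stdWord s m)) (pluckerMask 0) = 0 := by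
  have low : ∀ l₁ l₂ l₃ : List (Fin 6), l₁.length = s → l₂.length = s → l₃.length = s →
      l₁.toFinset = {0, 1} → l₂.toFinset = {2, 3} → l₃.toFinset = {4, 5} →
      word l₁ + word l₂ + word l₃ ∈ N →
      bitSum 64 (fun m => N.mkQ (stdWord s m)) (pluckerMask 0) = 0 := by
    intro l₁ l₂ l₃ e1 e2 e3 f1 f2 f3 h
    rw [bitSum_pluckerMask _ (by norm_num), ← mkQ_word_eq hN e1 (by omega) (f1.trans (by decide)),
      ← mkQ_word_eq hN e2 (by omega) (f2.trans (by decide)),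
      ← mkQ_word_eq hN e3 (by omega) (f3.trans (by decide)), ← map_add, ← map_add,
      ← LinearMap.mem_ker, N.ker_mkQ]
    exact h
  rcases (by omega : s = 2 ∨ s = 3 ∨ 4 ≤ s) with rfl | rfl | h4
  · exact low [0, 1] [2, 3] [4, 5] rfl rfl rfl (by decide) (by decide) (by decide)
      (hN.1 (word_plucker []))
  · exact low [0, 1, 1] [2, 2, 3] [4, 4, 5] rfl rfl rfl (by decide) (by decide) (by decide)
      (hN.1 word_cubic₀)
  · have hm : pluckerMask 0 = xorMasks pluckerMask [3, 12, 48] := by decide +kernel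
    rw [hm]
    refine bitSum_xorMasks fun U hU => ?_
    have key : ∀ U ∈ [3, 12, 48], U < 64 ∧ U ≠ 0 ∧ (bits 6 U).length ≤ 2 := by decide +kernel
    obtain ⟨a, b, c⟩ := key U hU
    exact bitSum_plucker_eq_zero hN a ⟨b, by omega⟩

theorem mkQ_word_mem_span {N : Submodule (ZMod 2) (Poly 4)} {s : ℕ} (hN : HasExchange N s)
    (hs : s ≠ 0) {l : List (Fin 6)} (hl : l.length = s) :
    N.mkQ (word l) ∈ Submodule.span (ZMod 2)
      ((fun m => N.mkQ (stdWord s m)) '' {m | m ∈ stdMasks ∧ (bits 6 m).length ≤ s}) := by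
  obtain ⟨V, hV, hlV⟩ := exists_bits_six l.toFinset
  have hVs := length_bits_le hlV.symm
  have hV0 : V ≠ 0 := by
    rintro rfl
    rw [show (bits 6 0).toFinset = ∅ by decide, eq_comm, List.toFinset_eq_empty_iff] at hlV
    exact hs (by rw [← hl, hlV, List.length_nil])
  obtain ⟨h1, h2⟩ := pluckerCert_spec V hV hV0
  rw [mkQ_word_eq hN hl hs hlV.symm]
  refine mem_span_of_bitSum_eq_zero (r := pluckerMask) (L := pluckerCert V) (fun U hU => ?_) hV
    fun j hj hb => ⟨(h2 j hj hb).1, (h2 j hj hb).2.trans (by omega)⟩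
  obtain ⟨h64, ⟨rfl, h⟩ | ⟨h, h'⟩⟩ := h1 U hU
  · exact bitSum_plucker_zero_eq_zero hN (by omega)
  · exact bitSum_plucker_eq_zero hN h64 ⟨h, by omega⟩

/-- The pairs of a set of triples of variables and a variable indexing a basis of the odd words:
the set with bit mask `m / 4` and the variable `m % 4`. -/
def oddStdMasks : List ℕ :=
  [4, 5, 6, 7, 8, 9, 10, 11, 16, 17, 18, 19, 32, 33, 34, 12, 13, 14, 15, 20, 21, 22, 23, 24, 25, 26,
    27, 36, 37, 38, 40, 41, 42, 48, 49, 28, 29, 30, 31, 44, 45, 46, 52, 53, 56]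

/-- The bit mask of the relation among odd words multiplied by the triples in `U`. -/
def oddMask (U : ℕ) : ℕ :=
  (1 <<< (4 * (U ||| 1))) ^^^ (1 <<< (4 * (U ||| 2) + 1)) ^^^ (1 <<< (4 * (U ||| 4) + 2)) ^^^
    (1 <<< (4 * (U ||| 8) + 3))

/-- The relations expressing an odd word in terms of the standard ones. -/
def oddCert (V : ℕ) : List ℕ :=
  (List.lookup V [(35, [0]), (39, [1]), (43, [2]), (47, [3]), (50, [0, 8]), (51, [4]),
    (54, [1, 9]), (55, [5]), (57, [0, 4, 8, 12]), (58, [2, 10]), (59, [6]),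
    (60, [0, 2, 4, 6, 8, 10, 12, 14]), (61, [1, 5, 9, 13]), (62, [3, 11]), (63, [7])]).getD []

set_option synthInstance.maxHeartbeats 400000 in
set_option synthInstance.maxSize 1000 in
theorem oddCert_spec : ∀ V < 64, 4 ≤ V →
    (∀ U ∈ oddCert V, U < 16 ∧ (U = 0 ∨ (bits 4 U).length + 1 ≤ (bits 4 (V / 4)).length)) ∧
    ∀ j < 64, ((1 <<< V) ^^^ xorMasks oddMask (oddCert V)).testBit j →
      j ∈ oddStdMasks ∧ (bits 4 (j / 4)).length ≤ (bits 4 (V / 4)).length := by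
  decide +kernel

/-- The odd word of length `n` attached to a bit mask. -/
noncomputable def oddStdWord (n m : ℕ) : Poly 4 :=
  bword (padBits 4 n (m / 4)) (Fin.ofNat 4 m)

theorem mkQ_bword_eq {n : ℕ} {l : List (Fin 4)} {i : Fin 4} {U : ℕ} (hl : l.length = n)
    (hn : n ≠ 0) (hU : l.toFinset = (bits 4 U).toFinset) :
    (hitSubmodule 4).mkQ (bword l i) = (hitSubmodule 4).mkQ (oddStdWord n (4 * U + i)) := by
  have h0 : bits 4 U ≠ [] := by
    intro h
    rw [h, List.toFinset_nil, List.toFinset_eq_empty_iff] at hU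
    exact hn (by rw [← hl, hU, List.length_nil])
  have e1 : (4 * U + (i : ℕ)) / 4 = U := by omega
  have e2 : Fin.ofNat 4 (4 * U + i) = i := by ext; simp [Fin.ofNat]
  rw [oddStdWord, e1, e2]
  exact eq_of_toFinset_eq (c := fun l => (hitSubmodule 4).mkQ (bword l i))
    (fun l l' h => mkQ_eq_mkQ.2 (bword_perm h i))
    (fun p q l hpq h => mkQ_eq_mkQ.2 (bword_exchange hpq l i)) hl
    (length_padBits (hl ▸ length_bits_le hU)) (hU.trans (toFinset_padBits h0).symm)

theorem toFinset_bits_or_two_pow : ∀ U < 16,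
    (∀ i : Fin 4, insert i (bits 4 U).toFinset = (bits 4 (U ||| 2 ^ (i : ℕ))).toFinset) ∧
      U ||| 1 < 16 ∧ U ||| 2 < 16 ∧ U ||| 4 < 16 ∧ U ||| 8 < 16 := by
  decide +kernel

theorem bitSum_oddMask {M : Type*} [AddCommGroup M] [Module (ZMod 2) M] (k : ℕ → M) {U : ℕ}
    (hU : U < 16) :
    bitSum 64 k (oddMask U) = ∑ i : Fin 4, k (4 * (U ||| 2 ^ (i : ℕ)) + i) := by
  obtain ⟨h1, h2, h3, h4⟩ := (toFinset_bits_or_two_pow U hU).2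
  rw [oddMask, bitSum_xor, bitSum_xor, bitSum_xor, bitSum_one_shiftLeft k (by omega),
    bitSum_one_shiftLeft k (by omega), bitSum_one_shiftLeft k (by omega),
    bitSum_one_shiftLeft k (by omega), Fin.sum_univ_four]
  rfl

theorem bitSum_odd_eq_zero {n U : ℕ} (hn : n ≠ 0) (hU : U < 16)
    (h : U = 0 ∨ (bits 4 U).length + 1 ≤ n) :
    bitSum 64 (fun m => (hitSubmodule 4).mkQ (oddStdWord n m)) (oddMask U) = 0 := by
  suffices H : ∃ l : Fin 4 → List (Fin 4), (∀ i, (l i).length = n) ∧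
      (∀ i, (l i).toFinset = insert i (bits 4 U).toFinset) ∧
      ∑ i, bword (l i) i ∈ hitSubmodule 4 by
    obtain ⟨l, h1, h2, h3⟩ := H
    rw [bitSum_oddMask _ hU]
    simp only [← fun i => mkQ_bword_eq (h1 i) hn
      ((h2 i).trans ((toFinset_bits_or_two_pow U hU).1 i)) (i := i)]
    rw [← map_sum, ← LinearMap.mem_ker, Submodule.ker_mkQ]
    exact h3
  obtain ⟨m, rfl⟩ := Nat.exists_eq_succ_of_ne_zero hn
  by_cases hU0 : U = 0
  · subst hU0
    refine ⟨fun i => List.replicate (m + 1) i, fun i => List.length_replicate, fun i => ?_,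
      sum_bword_replicate_mem_hit m⟩
    rw [List.toFinset_replicate_of_ne_zero (by omega), show bits 4 0 = [] by decide]
    rfl
  · have h0 : bits 4 U ≠ [] := by
      have key : ∀ U < 16, U ≠ 0 → bits 4 U ≠ [] := by decide +kernel
      exact key U hU hU0
    refine ⟨fun i => i :: padBits 4 m U, fun i => ?_, fun i => ?_, sum_bword_cons_mem_hit _⟩
    · rw [List.length_cons, length_padBits (by omega)]
    · rw [List.toFinset_cons, toFinset_padBits h0]

theorem mkQ_bword_mem_span {n : ℕ} (hn : n ≠ 0) {l : List (Fin 4)} (hl : l.length = n)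
    (i : Fin 4) : (hitSubmodule 4).mkQ (bword l i) ∈ Submodule.span (ZMod 2)
      ((fun m => (hitSubmodule 4).mkQ (oddStdWord n m)) ''
        {m | m ∈ oddStdMasks ∧ (bits 4 (m / 4)).length ≤ n}) := by
  obtain ⟨U, hU, hlU⟩ := exists_bits_four l.toFinset
  have hUn := length_bits_le hlU.symm
  have hU0 : U ≠ 0 := by
    rintro rfl
    rw [show (bits 4 0).toFinset = ∅ by decide, eq_comm, List.toFinset_eq_empty_iff] at hlU
    exact hn (by rw [← hl, hlU, List.length_nil])
  have hV : 4 * U + (i : ℕ) < 64 := by omega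
  obtain ⟨h1, h2⟩ := oddCert_spec _ hV (by omega)
  have e1 : (4 * U + (i : ℕ)) / 4 = U := by omega
  rw [e1] at h1 h2
  rw [mkQ_bword_eq hl hn hlU.symm]
  exact mem_span_of_bitSum_eq_zero (r := oddMask) (L := oddCert (4 * U + i))
    (fun U hU => bitSum_odd_eq_zero hn (h1 U hU).1
      ((h1 U hU).2.imp_right fun h => h.trans (by omega))) hV
    fun j hj hb => ⟨(h2 j hj hb).1, (h2 j hj hb).2.trans (by omega)⟩

/-- The bit masks indexing the basis words of length `s`. -/
def evenIx (s : ℕ) : Finset ℕ := stdMasks.toFinset.filter fun m => (bits 6 m).length ≤ s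

/-- The bit masks indexing the basis odd words of length `n`. -/
def oddIx (n : ℕ) : Finset ℕ :=
  if n = 0 then {0, 1, 2, 3} else oddStdMasks.toFinset.filter fun m => (bits 4 (m / 4)).length ≤ n

theorem coe_evenIx (s : ℕ) : (evenIx s : Set ℕ) = {m | m ∈ stdMasks ∧ (bits 6 m).length ≤ s} := by
  ext m
  simp [evenIx]

theorem coe_oddIx {n : ℕ} (hn : n ≠ 0) :
    (oddIx n : Set ℕ) = {m | m ∈ oddStdMasks ∧ (bits 4 (m / 4)).length ≤ n} := by
  ext m
  simp [oddIx, hn]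

theorem mem_span_sup_of_mkQ_mem {k : ℕ} {N : Submodule (ZMod 2) (Poly k)} {w : ℕ → Poly k}
    {S : Set ℕ} {f : Poly k}
    (h : N.mkQ f ∈ Submodule.span (ZMod 2) ((fun m => N.mkQ (w m)) '' S)) :
    f ∈ Submodule.span (ZMod 2) (w '' S) ⊔ N := by
  rw [show (fun m => N.mkQ (w m)) '' S = N.mkQ '' (w '' S) by rw [Set.image_image],
    ← Submodule.map_span, ← Submodule.mem_comap, Submodule.comap_map_mkQ] at h
  rwa [sup_comm]

theorem mem_odd_span (n : ℕ) {f : Poly 4} (hf : f.IsHomogeneous (2 ^ (n + 2) - 3)) :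
    f ∈ Submodule.span (ZMod 2) (oddStdWord n '' oddIx n) ⊔ hitSubmodule 4 := by
  refine (sup_le (Submodule.span_le.2 ?_) le_sup_right : bwordSpan n ⊔ hitSubmodule 4 ≤ _)
    (mem_bwordSpan_sup_hit n f hf)
  rintro _ ⟨l, i, hl, rfl⟩
  by_cases hn : n = 0
  · subst hn
    rw [List.length_eq_zero_iff] at hl
    subst hl
    refine Submodule.mem_sup_left (Submodule.subset_span ⟨i, ?_, ?_⟩)
    · fin_cases i <;> simp [oddIx]
    · have h : ∀ i : Fin 4, padBits 4 0 (i / 4) = [] ∧ Fin.ofNat 4 i = i := by decide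
      rw [oddStdWord, (h i).1, (h i).2]
  · rw [coe_oddIx hn]
    exact mem_span_sup_of_mkQ_mem (mkQ_bword_mem_span hn hl i)

theorem length_padBits_of_mem_oddIx {n m : ℕ} (hm : m ∈ oddIx n) :
    (padBits 4 n (m / 4)).length = n := by
  refine length_padBits ?_
  by_cases h0 : n = 0
  · subst h0
    have : ∀ m ∈ oddIx 0, (bits 4 (m / 4)).length ≤ 0 := by decide
    exact this m hm
  · rw [← Finset.mem_coe, coe_oddIx h0] at hm
    exact hm.2

theorem isHomogeneous_oddStdWord {n m : ℕ} (hm : m ∈ oddIx n) :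
    (oddStdWord n m).IsHomogeneous (2 ^ (n + 2) - 3) := by
  have := isHomogeneous_bword (padBits 4 n (m / 4)) (Fin.ofNat 4 m)
  rwa [length_padBits_of_mem_oddIx hm] at this

/-- The hit polynomials, together with the defect of the exchange relation for `s = 3`. -/
noncomputable def exchangeSubmodule (s : ℕ) : Submodule (ZMod 2) (Poly 4) :=
  hitSubmodule 4 ⊔ Submodule.span (ZMod 2) {f | s = 3 ∧ f = defect}

theorem hasExchange (s : ℕ) : HasExchange (exchangeSubmodule s) s := by
  refine ⟨le_sup_left, fun p q l hpq hl => ?_⟩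
  cases l with
  | nil =>
    by_cases h : q = opp p
    · subst h
      have h1 := Submodule.mem_sup_left (T := Submodule.span (ZMod 2) {f | s = 3 ∧ f = defect})
        (word_defect p)
      have h2 : defect ∈ exchangeSubmodule s :=
        Submodule.mem_sup_right (Submodule.subset_span ⟨hl.symm, rfl⟩)
      have h3 := add_mem h1 h2
      rwa [add_assoc, CharTwo.add_self_eq_zero, add_zero] at h3
    · exact Submodule.mem_sup_left (word_overlap h [])
  | cons x l => exact Submodule.mem_sup_left (word_exchange hpq l)

theorem wordSpan_le {s : ℕ} (hs : s ≠ 0) :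
    wordSpan s ≤ Submodule.span (ZMod 2) (stdWord s '' evenIx s) ⊔ exchangeSubmodule s := by
  refine sup_le (Submodule.span_le.2 ?_) ((hasExchange s).1.trans le_sup_right)
  rintro _ ⟨l, hl, rfl⟩
  rw [coe_evenIx]
  exact mem_span_sup_of_mkQ_mem (mkQ_word_mem_span (hasExchange s) hs hl)

/-- The product of all four variables with the square of an odd word. -/
noncomputable def liftedOddWord (n m : ℕ) : Poly 4 := X 0 * X 1 * X 2 * X 3 * oddStdWord n m ^ 2

/-- The bit masks indexing the basis elements of degree `2 ^ (s + 1) - 2` divisible by all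
four variables with odd exponents. -/
def liftedIx (s : ℕ) : Finset ℕ := if s = 1 then ∅ else oddIx (s - 2)

theorem mem_basis_span {s : ℕ} (hs : s ≠ 0) {f : Poly 4} (hf : f.IsHomogeneous (2 ^ (s + 1) - 2)) :
    f ∈ Submodule.span (ZMod 2) (stdWord s '' evenIx s) ⊔
      Submodule.span (ZMod 2) {f | s = 3 ∧ f = defect} ⊔
      Submodule.span (ZMod 2) (liftedOddWord (s - 2) '' liftedIx s) ⊔ hitSubmodule 4 := by
  set W := Submodule.span (ZMod 2) (stdWord s '' evenIx s) ⊔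
      Submodule.span (ZMod 2) {f | s = 3 ∧ f = defect} ⊔
      Submodule.span (ZMod 2) (liftedOddWord (s - 2) '' liftedIx s) ⊔ hitSubmodule 4 with hW
  have hN : hitSubmodule 4 ≤ W := le_sup_right
  have hw : wordSpan s ≤ W := by
    refine (wordSpan_le hs).trans ?_
    rw [hW, exchangeSubmodule]
    exact sup_le (le_sup_of_le_left (le_sup_of_le_left le_sup_left)) (sup_le le_sup_right
      (le_sup_of_le_left (le_sup_of_le_left le_sup_right)))
  have pair : ∀ (i j : Fin 4) (z : Poly 4), i ≠ j → z.IsHomogeneous (2 ^ s - 2) →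
      X i * X j * z ^ 2 ∈ W := by
    obtain ⟨t, rfl⟩ := Nat.exists_eq_succ_of_ne_zero hs
    exact fun i j z hij hz => hw (pair_mul_sq_mem_wordSpan t i j hij z hz)
  have h2 : 2 ^ 1 ≤ 2 ^ s := Nat.pow_le_pow_right (by norm_num) (by omega)
  refine map_homogeneous_mem (fun z => z) rfl (fun _ _ => rfl) (fun a ha => ?_) hf
  obtain ⟨Y, b, hab, hd⟩ := exists_monomial_eq a
  have h4 : Y.card ≤ 4 := by simpa using Y.card_le_univ
  rw [ha, pow_succ] at hd
  have hb := isHomogeneous_monomial_one b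
  have hY : Y.card = 0 ∨ Y.card = 2 ∨ Y.card = 4 := by omega
  rcases hY with hY | hY | hY
  · rw [Finset.card_eq_zero] at hY
    subst hY
    rw [Finset.prod_empty, one_mul] at hab
    rw [hab]
    refine hN (sq_mem_hit_of_isHomogeneous hb ?_)
    rw [Finset.card_empty] at hd
    omega
  · obtain ⟨c, d, hcd, rfl⟩ := Finset.card_eq_two.1 hY
    rw [Finset.prod_pair hcd] at hab
    rw [hab]
    refine pair c d _ hcd ?_
    rwa [show 2 ^ s - 2 = b.degree by omega]
  · have hu : Y = Finset.univ := Finset.eq_univ_of_card Y (by simpa using hY)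
    rw [hu, Fin.prod_univ_four] at hab
    rw [hab]
    have hs1 : s ≠ 1 := by
      rintro rfl
      omega
    obtain ⟨n, rfl⟩ : ∃ n, s = n + 2 := ⟨s - 2, by omega⟩
    have hb' : b.degree = 2 ^ (n + 2) - 3 := by omega
    have hn := four_le_two_pow n
    rw [hb'] at hb
    obtain ⟨g, hg, h, hh, hgh⟩ := Submodule.mem_sup.1 (mem_odd_span n hb)
    have hg' : g.IsHomogeneous (2 ^ (n + 2) - 3) := by
      rw [← mem_homogeneousSubmodule]
      refine (Submodule.span_le.2 ?_ : _ ≤ homogeneousSubmodule _ _ _) hg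
      rintro _ ⟨m, hm, rfl⟩
      exact isHomogeneous_oddStdWord hm
    have hh' : h.IsHomogeneous (2 ^ (n + 2) - 3) := by
      rw [← hgh] at hb
      have := hb.sub hg'
      rwa [add_sub_cancel_left] at this
    rw [← hgh, add_pow_char, mul_add]
    refine add_mem (span_map_mem (fun f => X 0 * X 1 * X 2 * X 3 * f ^ 2) (by simp)
      (fun f g => by simp only [add_pow_char]; ring) ?_ hg)
      (X_prod_mul_hit_sq_mem hh hh' hN fun i j z hij hz => pair i j z hij.ne ?_)
    · rintro _ ⟨m, hm, rfl⟩
      refine Submodule.mem_sup_left (Submodule.mem_sup_right (Submodule.subset_span ⟨m, ?_, rfl⟩))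
      rwa [liftedIx, if_neg hs1]
    · rwa [show 2 ^ (n + 2) - 2 = 2 ^ (n + 2) - 3 + 1 by omega]

theorem induction_on_monomial {k : ℕ} {P : Poly k → Prop} (f : Poly k) (h0 : P 0)
    (hm : ∀ a : Fin k →₀ ℕ, P (monomial a 1)) (hadd : ∀ f g, P f → P g → P (f + g)) : P f := by
  induction f using MvPolynomial.induction_on' with
  | monomial a c =>
    have hc : c = 0 ∨ c = 1 := by revert c; decide
    rcases hc with rfl | rfl
    · rwa [monomial_zero]
    · exact hm a
  | add f g hf hg => exact hadd f g hf hg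

theorem hit_le_of_monomial {k : ℕ} {N : Submodule (ZMod 2) (Poly k)}
    (h : ∀ i (a : Fin k →₀ ℕ), 0 < i → sq i (monomial a 1) ∈ N) : hitSubmodule k ≤ N := by
  refine hit_le fun i f hi => ?_
  induction f using induction_on_monomial with
  | h0 => rw [map_zero]; exact zero_mem _
  | hm a => exact h i a hi
  | hadd f g hf hg => rw [map_add]; exact add_mem hf hg

theorem monomial_one_eq_prod {k : ℕ} (a : Fin k →₀ ℕ) :
    (monomial a 1 : Poly k) = ∏ j, X j ^ a j := by
  rw [monomial_eq, Finsupp.prod_fintype _ _ fun i => pow_zero _, C_1, one_mul]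

theorem sqSeries_X_pow {k : ℕ} (j : Fin k) (n : ℕ) : sqSeries k (X j ^ n) =
    ∑ m ∈ Finset.range (n + 1), Polynomial.monomial m ((n.choose m : Poly k) * X j ^ (n + m)) := by
  ext1 i
  rw [← sq_apply, sq_X_pow, Polynomial.finsetSum_coeff]
  simp only [Polynomial.coeff_monomial, Finset.sum_ite_eq', Finset.mem_range]
  split_ifs with h
  · rfl
  · rw [Nat.choose_eq_zero_of_lt (by omega), Nat.cast_zero, zero_mul]

theorem prod_polynomial_monomial {R ι : Type*} [CommSemiring R] (s : Finset ι) (m : ι → ℕ)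
    (c : ι → R) :
    ∏ j ∈ s, Polynomial.monomial (m j) (c j) =
      Polynomial.monomial (∑ j ∈ s, m j) (∏ j ∈ s, c j) := by
  classical
  induction s using Finset.induction_on with
  | empty => simp
  | insert a s ha ih =>
    rw [Finset.prod_insert ha, ih, Polynomial.monomial_mul_monomial, Finset.sum_insert ha,
      Finset.prod_insert ha]

theorem sq_monomial {k : ℕ} (i : ℕ) (a : Fin k →₀ ℕ) : sq i (monomial a 1 : Poly k) =
    ∑ m ∈ Fintype.piFinset fun j => Finset.range (a j + 1), if ∑ j, m j = i then
      monomial (a + Finsupp.equivFunOnFinite.symm m) ((∏ j, (a j).choose (m j) : ℕ) : ZMod 2)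
    else 0 := by
  rw [sq_apply, monomial_one_eq_prod, map_prod]
  simp only [sqSeries_X_pow]
  rw [Finset.prod_univ_sum, Polynomial.finsetSum_coeff]
  refine Finset.sum_congr rfl fun m _ => ?_
  rw [prod_polynomial_monomial, Polynomial.coeff_monomial]
  refine if_congr Iff.rfl ?_ rfl
  rw [Finset.prod_mul_distrib, ← mul_one ((∏ j, (a j).choose (m j) : ℕ) : ZMod 2), ← C_mul_monomial,
    monomial_one_eq_prod, C_eq_coe_nat]
  push_cast
  rfl

theorem coeff_eq_zero_of_mem_hit {k : ℕ} {f : Poly k} (hf : f ∈ hitSubmodule k)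
    {b : Fin k →₀ ℕ} (hb : b.degree ≤ 1) : coeff b f = 0 := by
  refine LinearMap.mem_ker.1
    (hit_le_of_monomial (N := LinearMap.ker (lcoeff (ZMod 2) b)) (fun i a hi => ?_) hf)
  rw [LinearMap.mem_ker, sq_monomial, map_sum]
  refine Finset.sum_eq_zero fun m hm => ?_
  rw [Fintype.mem_piFinset] at hm
  split_ifs with h
  · rw [lcoeff_apply, coeff_monomial, if_neg]
    rintro rfl
    have h1 : ∑ j, m j ≤ ∑ j, a j := Finset.sum_le_sum fun j _ => by
      have := Finset.mem_range.1 (hm j); omega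
    rw [Finsupp.degree_eq_sum] at hb
    simp only [Finsupp.add_apply, Finset.sum_add_distrib,
      Finsupp.equivFunOnFinite_symm_apply_apply] at hb
    omega
  · rw [map_zero]

/-- The Kameko map, halving the exponents of the monomials all of whose exponents are odd and
killing the other ones. -/
noncomputable def kameko (k : ℕ) : Poly k →ₗ[ZMod 2] Poly k :=
  (basisMonomials (Fin k) (ZMod 2)).constr (ZMod 2) fun a =>
    if ∀ i, Odd (a i) then monomial (Finsupp.equivFunOnFinite.symm fun i => a i / 2) 1 else 0

theorem kameko_monomial {k : ℕ} (a : Fin k →₀ ℕ) : kameko k (monomial a 1) =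
    if ∀ i, Odd (a i) then monomial (Finsupp.equivFunOnFinite.symm fun i => a i / 2) 1 else 0 := by
  have := (basisMonomials (Fin k) (ZMod 2)).constr_basis (ZMod 2) (fun a =>
    if ∀ i, Odd (a i) then monomial (Finsupp.equivFunOnFinite.symm fun i => a i / 2) (1 : ZMod 2)
    else 0) a
  rwa [coe_basisMonomials] at this

theorem kameko_mul_sq {k : ℕ} (f g : Poly k) : kameko k (f * g ^ 2) = kameko k f * g := by
  induction g using induction_on_monomial with
  | h0 => simp
  | hadd g h hg hh => rw [add_pow_char, mul_add, map_add, hg, hh, mul_add]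
  | hm b =>
    induction f using induction_on_monomial with
    | h0 => simp
    | hadd f h hf hh => rw [add_mul, map_add, hf, hh, map_add, add_mul]
    | hm a =>
      rw [monomial_pow, one_pow, monomial_mul, mul_one, kameko_monomial, kameko_monomial]
      have h : (∀ i, Odd ((a + 2 • b) i)) ↔ ∀ i, Odd (a i) := by
        refine forall_congr' fun i => ?_
        simp [Nat.odd_add]
      simp only [h]
      split_ifs with ha
      · rw [monomial_mul, mul_one]
        refine congrArg (fun c => monomial c 1) (Finsupp.ext fun i => ?_)
        simp only [Finsupp.equivFunOnFinite_symm_apply_apply, Finsupp.add_apply,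
          Finsupp.smul_apply, smul_eq_mul]
        omega
      · rw [zero_mul]

theorem kameko_prod_X (k : ℕ) : kameko k (∏ i, X i) = 1 := by
  have h : (∏ i, X i : Poly k) = monomial (Finsupp.equivFunOnFinite.symm fun _ => 1) 1 := by
    rw [monomial_one_eq_prod]; simp
  rw [h, kameko_monomial, if_pos (by simp)]
  have : (Finsupp.equivFunOnFinite.symm fun _ => 0 : Fin k →₀ ℕ) = 0 := by ext; simp
  simp [this]

theorem kameko_prod_X_of_ne {k : ℕ} {Y : Finset (Fin k)} (hY : Y ≠ Finset.univ) :
    kameko k (∏ i ∈ Y, X i) = 0 := by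
  classical
  have h : (∏ i ∈ Y, X i : Poly k) =
      monomial (Finsupp.equivFunOnFinite.symm fun i => if i ∈ Y then 1 else 0) 1 := by
    rw [monomial_one_eq_prod]; simp
  obtain ⟨i, hi⟩ : ∃ i, i ∉ Y := by simpa [Finset.eq_univ_iff_forall] using hY
  rw [h, kameko_monomial, if_neg fun H => by simpa [hi] using H i]

theorem kameko_sq_prod_X {k i : ℕ} (hi : 0 < i) (Y : Finset (Fin k)) :
    kameko k (sq i (∏ j ∈ Y, X j)) = 0 := by
  classical
  obtain ⟨a, h, hle⟩ : ∃ a : Fin k →₀ ℕ, (∏ i ∈ Y, X i : Poly k) = monomial a 1 ∧ ∀ j, a j ≤ 1 := by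
    refine ⟨Finsupp.equivFunOnFinite.symm fun i => if i ∈ Y then 1 else 0, ?_, fun j => ?_⟩
    · rw [monomial_one_eq_prod]; simp
    · rw [Finsupp.equivFunOnFinite_symm_apply_apply]; split_ifs <;> omega
  rw [h, sq_monomial, map_sum]
  refine Finset.sum_eq_zero fun m hm => ?_
  rw [Fintype.mem_piFinset] at hm
  split_ifs with hs
  · obtain ⟨j, -, hj⟩ : ∃ j ∈ Finset.univ, m j ≠ 0 :=
      Finset.exists_ne_zero_of_sum_ne_zero (by omega)
    have h1 := Finset.mem_range.1 (hm j)
    have h2 := hle j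
    rw [← mul_one (Nat.cast _), ← C_mul_monomial, ← smul_eq_C_mul, map_smul, kameko_monomial,
      if_neg, smul_zero]
    intro H
    have h3 := H j
    rw [Finsupp.add_apply, Finsupp.equivFunOnFinite_symm_apply_apply,
      show a j + m j = 2 by omega] at h3
    exact absurd h3 (by decide)
  · rw [map_zero]

theorem kameko_mem_hit {k : ℕ} {f : Poly k} (hf : f ∈ hitSubmodule k) :
    kameko k f ∈ hitSubmodule k := by
  refine Submodule.mem_comap.1
    (hit_le_of_monomial (N := (hitSubmodule k).comap (kameko k)) (fun i a hi => ?_) hf)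
  obtain ⟨Y, b, hab, -⟩ := exists_monomial_eq a
  rw [Submodule.mem_comap, hab, sq_mul, map_sum]
  refine sum_mem fun p hp => ?_
  have hp := Finset.HasAntidiagonal.mem_antidiagonal.1 hp
  obtain ⟨c, hc | hc⟩ := Nat.even_or_odd' p.2
  · rw [hc, sq_bit_sq, kameko_mul_sq]
    rcases Nat.eq_zero_or_pos p.1 with h0 | h0
    · rw [h0, sq_zero]
      by_cases hY : Y = Finset.univ
      · rw [hY, kameko_prod_X, one_mul]
        exact sq_mem_hit (by omega) _
      · rw [kameko_prod_X_of_ne hY, zero_mul]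
        exact zero_mem _
    · rw [kameko_sq_prod_X h0, zero_mul]
      exact zero_mem _
  · rw [hc, sq_odd_sq, mul_zero, map_zero]
    exact zero_mem _

theorem kameko_iterate_mem_hit {k : ℕ} (n : ℕ) {f : Poly k} (hf : f ∈ hitSubmodule k) :
    (kameko k ^ n) f ∈ hitSubmodule k := by
  induction n generalizing f with
  | zero => simpa using hf
  | succ n ih =>
    rw [pow_succ, Module.End.mul_apply]
    exact ih (kameko_mem_hit hf)

/-- The linear form with coefficients `a`. -/
noncomputable def linForm {l : ℕ} (a : Fin l → ZMod 2) : Poly l := ∑ i, a i • X i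

theorem sqSeries_linForm {l : ℕ} (a : Fin l → ZMod 2) : sqSeries l (linForm a) =
    Polynomial.C (linForm a) + Polynomial.C (linForm a ^ 2) * Polynomial.X := by
  have h : ∀ i, sqSeries l (a i • X i) =
      Polynomial.C (a i • X i) + Polynomial.C ((a i • X i) ^ 2) * Polynomial.X := by
    intro i
    have hc : a i = 0 ∨ a i = 1 := by generalize a i = c; revert c; decide
    rcases hc with hc | hc
    · simp [hc]
    · rw [hc, one_smul, sqSeries_X]
  rw [linForm, map_sum, sum_pow_char, map_sum, map_sum, Finset.sum_mul, ← Finset.sum_add_distrib]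
  exact Finset.sum_congr rfl fun i _ => h i

/-- The linear substitution with matrix `A`. -/
noncomputable def linSubst {l k : ℕ} (A : Fin l → Fin k → ZMod 2) : Poly k →ₐ[ZMod 2] Poly l :=
  aeval fun j => linForm fun i => A i j

theorem sq_linSubst {l k : ℕ} (A : Fin l → Fin k → ZMod 2) (i : ℕ) (f : Poly k) :
    linSubst A (sq i f) = sq i (linSubst A f) := by
  have h : ((Polynomial.mapAlgHom (linSubst A)).comp (sqSeries k)) =
      (sqSeries l).comp (linSubst A) := by
    refine MvPolynomial.algHom_ext fun j => ?_
    simp [linSubst, sqSeries_linForm, sqSeries_X]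
  have := congrArg (fun p => p.coeff i) (DFunLike.congr_fun h f)
  simpa [sq_apply, Polynomial.coe_mapAlgHom] using this

theorem linSubst_mem_hit {l k : ℕ} (A : Fin l → Fin k → ZMod 2) {f : Poly k}
    (hf : f ∈ hitSubmodule k) : linSubst A f ∈ hitSubmodule l := by
  refine Submodule.mem_comap.1
    (hit_le (N := (hitSubmodule l).comap (linSubst A).toLinearMap) (fun i f hi => ?_) hf)
  rw [Submodule.mem_comap, AlgHom.toLinearMap_apply, sq_linSubst]
  exact sq_mem_hit hi _

/-- The coefficient of the monomial with exponent `b` after a linear substitution and `s`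
applications of the Kameko map. -/
noncomputable def kamekoEval {l k : ℕ} (A : Fin l → Fin k → ZMod 2) (s : ℕ) (b : Fin l →₀ ℕ) :
    Poly k →ₗ[ZMod 2] ZMod 2 :=
  (lcoeff (ZMod 2) b).comp ((kameko l ^ s).comp (linSubst A).toLinearMap)

theorem kamekoEval_of_mem_hit {l k : ℕ} (A : Fin l → Fin k → ZMod 2) (s : ℕ) {b : Fin l →₀ ℕ}
    (hb : b.degree ≤ 1) {f : Poly k} (hf : f ∈ hitSubmodule k) : kamekoEval A s b f = 0 :=
  coeff_eq_zero_of_mem_hit (kameko_iterate_mem_hit s (linSubst_mem_hit A hf)) hb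

theorem kamekoEval_mul_sq {l k : ℕ} {A : Fin l → Fin k → ZMod 2} {s : ℕ} {b : Fin l →₀ ℕ}
    {f g : Poly k} {d : ZMod 2} (hf : kameko l (linSubst A f) = C d) :
    kamekoEval A (s + 1) b (f * g ^ 2) = d * kamekoEval A s b g := by
  have h (x : Poly l) : (kameko l ^ (s + 1)) x = (kameko l ^ s) (kameko l x) := by
    rw [pow_succ, Module.End.mul_apply]
  simp only [kamekoEval, LinearMap.comp_apply, AlgHom.toLinearMap_apply, map_mul, map_pow, h,
    kameko_mul_sq, hf]
  rw [← smul_eq_C_mul, map_smul, map_smul, smul_eq_mul]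

theorem linSubst_X {l k : ℕ} (A : Fin l → Fin k → ZMod 2) (j : Fin k) :
    linSubst A (X j) = linForm fun i => A i j := aeval_X _ _

theorem kameko_one {k : ℕ} : kameko (k + 1) 1 = 0 := by
  have := kameko_prod_X_of_ne (k := k + 1) (Y := ∅) Finset.univ_nonempty.ne_empty.symm
  rwa [Finset.prod_empty] at this

theorem kameko_X {k : ℕ} (j : Fin (k + 2)) : kameko (k + 2) (X j) = 0 := by
  have := kameko_prod_X_of_ne (k := k + 2) (Y := {j}) (by
    intro h
    have := congrArg Finset.card h
    simp at this)
  rwa [Finset.prod_singleton] at this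

theorem kameko_linForm_mul (a b : Fin 2 → ZMod 2) :
    kameko 2 (linForm a * linForm b) = C (a 0 * b 1 + a 1 * b 0) := by
  have h : linForm a * linForm b = (a 0 * b 1 + a 1 * b 0) • ∏ i, X i +
      ((a 0 * b 0) • (1 * X 0 ^ 2) + (a 1 * b 1) • (1 * X 1 ^ 2)) := by
    simp only [linForm, Fin.sum_univ_two, Fin.prod_univ_two, smul_eq_C_mul, C_mul, C_add]
    ring
  rw [h]
  simp only [map_add, map_smul, kameko_prod_X, kameko_mul_sq, kameko_one, zero_mul, smul_zero,
    add_zero]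
  rw [smul_eq_C_mul, mul_one, C_add]

/-- The determinant of three vectors over `F_2`. -/
def det₃ (a b c : Fin 3 → ZMod 2) : ZMod 2 :=
  a 0 * (b 1 * c 2 + b 2 * c 1) + a 1 * (b 0 * c 2 + b 2 * c 0) + a 2 * (b 0 * c 1 + b 1 * c 0)

theorem kameko_linForm_mul_mul (a b c : Fin 3 → ZMod 2) :
    kameko 3 (linForm a * linForm b * linForm c) = C (det₃ a b c) := by
  have h : linForm a * linForm b * linForm c = det₃ a b c • ∏ i, X i +
      ((a 0 * b 0 * c 0) • (X 0 * X 0 ^ 2) + (a 1 * b 1 * c 1) • (X 1 * X 1 ^ 2) +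
      (a 2 * b 2 * c 2) • (X 2 * X 2 ^ 2) +
      (a 1 * b 0 * c 0 + a 0 * b 1 * c 0 + a 0 * b 0 * c 1) • (X 1 * X 0 ^ 2) +
      (a 2 * b 0 * c 0 + a 0 * b 2 * c 0 + a 0 * b 0 * c 2) • (X 2 * X 0 ^ 2) +
      (a 0 * b 1 * c 1 + a 1 * b 0 * c 1 + a 1 * b 1 * c 0) • (X 0 * X 1 ^ 2) +
      (a 2 * b 1 * c 1 + a 1 * b 2 * c 1 + a 1 * b 1 * c 2) • (X 2 * X 1 ^ 2) +
      (a 0 * b 2 * c 2 + a 2 * b 0 * c 2 + a 2 * b 2 * c 0) • (X 0 * X 2 ^ 2) +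
      (a 1 * b 2 * c 2 + a 2 * b 1 * c 2 + a 2 * b 2 * c 1) • (X 1 * X 2 ^ 2)) := by
    simp only [linForm, Fin.sum_univ_three, Fin.prod_univ_three, det₃, smul_eq_C_mul, C_mul, C_add]
    ring
  rw [h]
  simp only [map_add, map_smul, kameko_prod_X, kameko_mul_sq, kameko_X, zero_mul, smul_zero,
    add_zero]
  rw [smul_eq_C_mul, mul_one]

/-- The `r`-th binary digit of `m` as an element of `F_2`. -/
def bit (m r : ℕ) : ZMod 2 := if m.testBit r then 1 else 0

theorem bit_xor (m n r : ℕ) : bit (m ^^^ n) r = bit m r + bit n r := by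
  simp only [bit, Nat.testBit_xor]
  cases m.testBit r <;> cases n.testBit r <;> decide

theorem bit_and (m n r : ℕ) : bit (m &&& n) r = bit m r * bit n r := by
  simp only [bit, Nat.testBit_and]
  cases m.testBit r <;> cases n.testBit r <;> decide

/-- The matrices of the linear substitutions into two variables, one for each binary digit. -/
def evenRows : Fin 2 → Fin 4 → ℕ :=
  ![![32338600063, 34226044800, 34359214080, 0],
    ![22906492160, 27487371349, 424422, 34359713400]]

/-- The determinants of the `p`-th pair of columns of `evenRows`. -/
def pairMask (p : Fin 6) : ℕ :=
  (evenRows 0 (fstIx p) &&& evenRows 1 (sndIx p)) ^^^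
    (evenRows 1 (fstIx p) &&& evenRows 0 (sndIx p))

theorem kamekoEval_word (r : ℕ) (l : List (Fin 6)) :
    kamekoEval (fun i j => bit (evenRows i j) r) l.length 0 (word l) =
      if l.all fun p => (pairMask p).testBit r then 1 else 0 := by
  induction l with
  | nil => simp [kamekoEval, word]
  | cons p l ih =>
    have h : kameko 2 (linSubst (fun i j => bit (evenRows i j) r) (pairMon p)) =
        C (bit (pairMask p) r) := by
      rw [pairMon, map_mul, linSubst_X, linSubst_X, kameko_linForm_mul, pairMask, bit_xor, bit_and,
        bit_and]
    rw [List.length_cons, word, kamekoEval_mul_sq h, ih, List.all_cons, bit]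
    cases (pairMask p).testBit r <;> simp

/-- The matrices of the linear substitutions into three variables, one for each binary digit. -/
def oddRows : Fin 3 → Fin 4 → ℕ :=
  ![![31762561147464, 7784112657473, 10069861802130, 20105347090724],
    ![34212381924784, 27365488518022, 5017746837577, 0],
    ![31270634536960, 3883061610496, 20096763445540, 15079010318043]]

/-- The determinants of the columns of `oddRows` other than the `p`-th one. -/
def tripleMask (p : Fin 4) : ℕ :=
  let a i := oddRows i (p.succAbove 0)
  let b i := oddRows i (p.succAbove 1)
  let c i := oddRows i (p.succAbove 2)
  (a 0 &&& ((b 1 &&& c 2) ^^^ (b 2 &&& c 1))) ^^^ (a 1 &&& ((b 0 &&& c 2) ^^^ (b 2 &&& c 0))) ^^^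
    (a 2 &&& ((b 0 &&& c 1) ^^^ (b 1 &&& c 0)))

theorem kamekoEval_bword (r : ℕ) (l : List (Fin 4)) (i : Fin 4) :
    kamekoEval (fun i j => bit (oddRows i j) r) l.length (Finsupp.single 0 1) (bword l i) =
      if (oddRows 0 i).testBit r && l.all fun p => (tripleMask p).testBit r then 1 else 0 := by
  induction l with
  | nil =>
    simp only [kamekoEval, bword, linSubst_X, linForm, Fin.sum_univ_three, bit, List.length_nil,
      pow_zero, LinearMap.comp_apply, AlgHom.toLinearMap_apply, Module.End.one_apply, lcoeff_apply,
      coeff_add, coeff_smul, coeff_X, List.all_nil, Bool.and_true]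
    simp [Finsupp.single_left_inj]
  | cons p l ih =>
    have h : kameko 3 (linSubst (fun i j => bit (oddRows i j) r) (triMon p)) =
        C (bit (tripleMask p) r) := by
      simp only [triMon, map_mul, linSubst_X, kameko_linForm_mul_mul, tripleMask, bit_xor, bit_and,
        det₃]
    rw [List.length_cons, bword, kamekoEval_mul_sq h, ih, List.all_cons, bit]
    cases (tripleMask p).testBit r <;> simp

theorem all_padBits {n s m : ℕ} [NeZero n] (h : bits n m ≠ []) (P : Fin n → Bool) :
    (padBits n s m).all P = (bits n m).all P := by
  have hmem : ∀ x, x ∈ padBits n s m ↔ x ∈ bits n m := fun x => by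
    rw [← List.mem_toFinset, toFinset_padBits h, List.mem_toFinset]
  rw [Bool.eq_iff_iff, List.all_eq_true, List.all_eq_true]
  simp only [hmem]

/-- The coefficients of the functionals dual to the basis words. -/
def evenDual (m : ℕ) : ℕ :=
  (List.lookup m (stdMasks.zip
    [1, 524288, 2, 512, 8, 128, 7, 1572866, 1537, 134742528, 404227591, 25, 8912904, 42, 33288, 385,
      2621568, 8322, 2688, 20054365388, 127, 26738730, 99865, 2290647560, 6871942783, 24967,
      7872642, 8065, 673712768, 2021162887, 524287, 20031646378, 133718527, 11453177753,
      34359738367])).getD 0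

theorem evenDual_spec : ∀ m ∈ stdMasks, ∀ m' ∈ stdMasks,
    (∑ r ∈ Finset.range 35, if (evenDual m).testBit r &&
      (bits 6 m').all fun p => (pairMask p).testBit r then 1 else 0) % 2 =
      if m' = m then 1 else 0 := by
  decide +kernel

/-- The coefficients of the functionals dual to the basis odd words. -/
def oddDual (m : ℕ) : ℕ :=
  (List.lookup m (oddStdMasks.zip
    [5163878494799, 1, 2, 4, 8, 1117501064240, 16, 32, 512, 1024, 34368129024, 2048, 2097152,
      4194304, 8388608, 9498557719430, 14387893835184, 146, 292, 5301283901517, 5121, 446718560256,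
      18436, 33288, 2216744321056, 3333171578880, 133152, 5163809288779, 20971521, 41943042,
      136314888, 1116959998992, 276824080, 8592032256, 17184064512, 18429909156100, 24281082888480,
      30135949608960, 1198372, 9494059328130, 14381967283344, 2457862290, 5017746837577,
      85920322561, 558482096648])).getD 0

theorem oddDual_spec : ∀ m ∈ oddStdMasks, ∀ m' ∈ oddStdMasks,
    (∑ r ∈ Finset.range 45, if (oddDual m).testBit r && ((oddRows 0 (Fin.ofNat 4 m')).testBit r &&
      (bits 4 (m' / 4)).all fun p => (tripleMask p).testBit r) then 1 else 0) % 2 =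
      if m' = m then 1 else 0 := by
  decide +kernel

theorem sum_ite_eq_of_mod_two {I : Finset ℕ} {P : ℕ → Bool} {Q : Prop} [Decidable Q]
    (h : (∑ r ∈ I, if P r then 1 else 0) % 2 = if Q then 1 else 0) :
    (∑ r ∈ I, if P r then (1 : ZMod 2) else 0) = if Q then 1 else 0 := by
  have h1 : ((∑ r ∈ I, if P r then 1 else 0 : ℕ) : ZMod 2) =
      ((if Q then 1 else 0 : ℕ) : ZMod 2) := by
    rw [← h, ZMod.natCast_mod]
  simpa using h1

/-- The functional dual to the basis word indexed by `m`. -/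
noncomputable def evenFunctional (s m : ℕ) : Poly 4 →ₗ[ZMod 2] ZMod 2 :=
  ∑ r ∈ Finset.range 35, if (evenDual m).testBit r then
    kamekoEval (fun i j => bit (evenRows i j) r) s 0 else 0

theorem evenFunctional_of_mem_hit (s m : ℕ) {f : Poly 4} (hf : f ∈ hitSubmodule 4) :
    evenFunctional s m f = 0 := by
  rw [evenFunctional, LinearMap.sum_apply]
  refine Finset.sum_eq_zero fun r _ => ?_
  split_ifs
  · exact kamekoEval_of_mem_hit _ s (by simp) hf
  · rfl

theorem evenFunctional_word (m : ℕ) (l : List (Fin 6)) :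
    evenFunctional l.length m (word l) = ∑ r ∈ Finset.range 35,
      if (evenDual m).testBit r && l.all fun p => (pairMask p).testBit r then 1 else 0 := by
  rw [evenFunctional, LinearMap.sum_apply]
  refine Finset.sum_congr rfl fun r _ => ?_
  cases (evenDual m).testBit r
  · simp
  · simp [kamekoEval_word]

theorem evenFunctional_stdWord {s m m' : ℕ} (hm : m ∈ evenIx s) (hm' : m' ∈ evenIx s) :
    evenFunctional s m (stdWord s m') = if m' = m then 1 else 0 := by
  simp only [evenIx, Finset.mem_filter, List.mem_toFinset] at hm hm'
  have h0 : ∀ m ∈ stdMasks, bits 6 m ≠ [] := by decide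
  have h := evenFunctional_word m (padBits 6 s m')
  rw [length_padBits hm'.2] at h
  rw [stdWord, h]
  simp only [all_padBits (h0 m' hm'.1)]
  exact sum_ite_eq_of_mod_two (evenDual_spec m hm.1 m' hm'.1)

theorem evenFunctional_defect (m : ℕ) : evenFunctional 3 m defect = 0 := by
  have h1 := evenFunctional_word m [0, 0, 1]
  have h2 := evenFunctional_word m [0, 1, 1]
  simp only [List.length_cons, List.length_nil, zero_add, Nat.reduceAdd] at h1 h2
  rw [defect, map_add, h1, h2]
  simp only [List.all_cons, Bool.and_self_left, ZModModule.add_self]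

/-- The functional dual to the basis odd word indexed by `m`. -/
noncomputable def oddFunctional (n m : ℕ) : Poly 4 →ₗ[ZMod 2] ZMod 2 :=
  if n = 0 then lcoeff (ZMod 2) (Finsupp.single (Fin.ofNat 4 m) 1) else
    ∑ r ∈ Finset.range 45, if (oddDual m).testBit r then
      kamekoEval (fun i j => bit (oddRows i j) r) n (Finsupp.single 0 1) else 0

theorem oddFunctional_of_mem_hit (n m : ℕ) {f : Poly 4} (hf : f ∈ hitSubmodule 4) :
    oddFunctional n m f = 0 := by
  rw [oddFunctional]
  split_ifs
  · exact coeff_eq_zero_of_mem_hit hf (by simp)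
  · rw [LinearMap.sum_apply]
    refine Finset.sum_eq_zero fun r _ => ?_
    split_ifs
    · exact kamekoEval_of_mem_hit _ n (by simp) hf
    · rfl

theorem oddFunctional_oddStdWord {n m m' : ℕ} (hm : m ∈ oddIx n) (hm' : m' ∈ oddIx n) :
    oddFunctional n m (oddStdWord n m') = if m' = m then 1 else 0 := by
  have hlen := length_padBits_of_mem_oddIx hm'
  by_cases hn : n = 0
  · subst hn
    have h : ∀ m ∈ oddIx 0, ∀ m' ∈ oddIx 0, (Fin.ofNat 4 m' = Fin.ofNat 4 m ↔ m' = m) := by decide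
    rw [oddFunctional, if_pos rfl, oddStdWord, List.length_eq_zero_iff.1 hlen, bword, lcoeff_apply,
      coeff_X, ← if_congr (h m hm m' hm') rfl rfl]
    simp only [Finsupp.single_left_inj one_ne_zero]
  · rw [← Finset.mem_coe, coe_oddIx hn] at hm hm'
    have h0 : ∀ m ∈ oddStdMasks, bits 4 (m / 4) ≠ [] := by decide
    rw [← sum_ite_eq_of_mod_two (oddDual_spec m hm.1 m' hm'.1), oddFunctional, if_neg hn,
      LinearMap.sum_apply]
    refine Finset.sum_congr rfl fun r _ => ?_
    have h := kamekoEval_bword r (padBits 4 n (m' / 4)) (Fin.ofNat 4 m')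
    rw [hlen, all_padBits (h0 m' hm'.1)] at h
    rw [oddStdWord]
    cases (oddDual m).testBit r
    · simp
    · simpa using h

theorem kameko_liftedOddWord (n m : ℕ) : kameko 4 (liftedOddWord n m) = oddStdWord n m := by
  have h := kameko_prod_X 4
  rw [Fin.prod_univ_four] at h
  rw [liftedOddWord, kameko_mul_sq, h, one_mul]

theorem kameko_word {l : List (Fin 6)} (hl : l ≠ []) : kameko 4 (word l) = 0 := by
  obtain ⟨p, l, rfl⟩ := List.exists_cons_of_ne_nil hl
  have hp : ∀ p, fstIx p ≠ sndIx p ∧ ({fstIx p, sndIx p} : Finset (Fin 4)) ≠ Finset.univ := by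
    decide
  have h := kameko_prod_X_of_ne (hp p).2
  rw [Finset.prod_pair (hp p).1] at h
  rw [word, kameko_mul_sq, pairMon, h, zero_mul]

theorem kameko_stdWord {s m : ℕ} (hs : s ≠ 0) (hm : m ∈ evenIx s) :
    kameko 4 (stdWord s m) = 0 := by
  simp only [evenIx, Finset.mem_filter] at hm
  refine kameko_word fun h => hs ?_
  rw [← length_padBits hm.2, h, List.length_nil]

theorem kameko_defect : kameko 4 defect = 0 := by
  rw [defect, map_add, kameko_word (by simp), kameko_word (by simp), add_zero]

theorem coeff_sq_monomial {k : ℕ} (i : ℕ) (a b : Fin k →₀ ℕ) :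
    coeff b (sq i (monomial a 1)) =
      if a ≤ b ∧ ∑ j, (b j - a j) = i then ((∏ j, (a j).choose (b j - a j) : ℕ) : ZMod 2)
      else 0 := by
  rw [sq_monomial, coeff_sum]
  have h (m : Fin k → ℕ) (hm : m ≠ fun j => b j - a j) :
      coeff b (if ∑ j, m j = i then monomial (a + Finsupp.equivFunOnFinite.symm m)
        ((∏ j, (a j).choose (m j) : ℕ) : ZMod 2) else 0) = 0 := by
    split_ifs
    · rw [coeff_monomial, if_neg]
      rintro rfl
      exact hm (funext fun j => by simp)
    · exact coeff_zero b
  rw [Finset.sum_eq_single (fun j => b j - a j) (fun m _ hm => h m hm) (fun hm => ?_)]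
  · by_cases hab : a ≤ b
    · have hb : a + Finsupp.equivFunOnFinite.symm (fun j => b j - a j) = b := by
        ext j
        have := hab j
        simp
        omega
      rw [hb]
      by_cases hi : ∑ j, (b j - a j) = i
      · rw [if_pos hi, if_pos ⟨hab, hi⟩, coeff_monomial, if_pos rfl]
      · rw [if_neg hi, if_neg fun h : a ≤ b ∧ _ => hi h.2, coeff_zero]
    · rw [if_neg fun h : a ≤ b ∧ _ => hab h.1]
      split_ifs
      · rw [coeff_monomial, if_neg]
        intro hb
        exact hab (hb ▸ le_self_add)
      · exact coeff_zero b
  · have : ∃ j, (a j).choose (b j - a j) = 0 := by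
      by_contra! hc
      refine hm (Fintype.mem_piFinset.2 fun j => Finset.mem_range.2 ?_)
      have := hc j
      rw [Ne, Nat.choose_eq_zero_iff] at this
      omega
    obtain ⟨j, hj⟩ := this
    rw [Finset.prod_eq_zero (Finset.mem_univ j) hj]
    simp

/-- The exponents of the monomials on which the functional detecting the defect is nonzero. -/
def defectSupport : List (Fin 4 → ℕ) :=
  [![1, 1, 6, 6], ![1, 2, 5, 6], ![1, 3, 5, 5], ![1, 4, 3, 6], ![1, 5, 5, 3], ![1, 6, 1, 6],
    ![1, 6, 2, 5], ![1, 6, 4, 3], ![2, 1, 6, 5], ![2, 2, 5, 5], ![2, 3, 3, 6], ![2, 4, 3, 5],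
    ![2, 5, 1, 6], ![2, 5, 2, 5], ![2, 5, 4, 3], ![2, 6, 3, 3], ![3, 1, 5, 5], ![3, 2, 6, 3],
    ![3, 3, 3, 5], ![3, 4, 1, 6], ![3, 4, 2, 5], ![3, 4, 4, 3], ![4, 1, 6, 3], ![4, 2, 5, 3],
    ![4, 3, 1, 6], ![4, 3, 2, 5], ![4, 3, 4, 3], ![4, 4, 3, 3], ![5, 1, 3, 5], ![5, 2, 1, 6],
    ![5, 2, 2, 5], ![5, 2, 4, 3], ![6, 1, 1, 6], ![6, 1, 2, 5], ![6, 1, 4, 3], ![6, 2, 3, 3]]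

set_option maxRecDepth 20000 in
theorem defectSupport_spec : ∀ a₀ < 7, ∀ a₁ < 7, ∀ a₂ < 7, ∀ a₃ < 7, a₀ + a₁ + a₂ + a₃ < 14 →
    (defectSupport.map fun b => if a₀ ≤ b 0 ∧ a₁ ≤ b 1 ∧ a₂ ≤ b 2 ∧ a₃ ≤ b 3 then
      a₀.choose (b 0 - a₀) * a₁.choose (b 1 - a₁) * a₂.choose (b 2 - a₂) * a₃.choose (b 3 - a₃)
      else 0).sum % 2 = 0 := by
  decide +kernel

/-- The functional detecting the defect of the exchange relation. -/
noncomputable def defectFunctional : Poly 4 →ₗ[ZMod 2] ZMod 2 :=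
  (defectSupport.map fun b => lcoeff (ZMod 2) (Finsupp.equivFunOnFinite.symm b)).sum

theorem defectFunctional_apply (f : Poly 4) : defectFunctional f =
    (defectSupport.map fun b => coeff (Finsupp.equivFunOnFinite.symm b) f).sum := by
  rw [defectFunctional]
  induction defectSupport with
  | nil => rfl
  | cons b L ih =>
    rw [List.map_cons, List.sum_cons, LinearMap.add_apply, ih, lcoeff_apply, List.map_cons,
      List.sum_cons]

theorem defectFunctional_of_mem_hit {f : Poly 4} (hf : f ∈ hitSubmodule 4) :
    defectFunctional f = 0 := by
  rw [← LinearMap.mem_ker]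
  refine hit_le_of_monomial (fun i a hi => ?_) hf
  rw [LinearMap.mem_ker, defectFunctional_apply]
  have hb : ∀ b ∈ defectSupport, b 0 < 7 ∧ b 1 < 7 ∧ b 2 < 7 ∧ b 3 < 7 ∧
      b 0 + b 1 + b 2 + b 3 = 14 := by decide
  by_cases ha : a 0 < 7 ∧ a 1 < 7 ∧ a 2 < 7 ∧ a 3 < 7 ∧ a 0 + a 1 + a 2 + a 3 + i = 14
  · have h := defectSupport_spec _ ha.1 _ ha.2.1 _ ha.2.2.1 _ ha.2.2.2.1 (by omega)
    rw [← Nat.dvd_iff_mod_eq_zero, ← ZMod.natCast_eq_zero_iff, Nat.cast_list_sum,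
      List.map_map] at h
    rw [← h]
    refine congrArg List.sum (List.map_congr_left fun b hbL => ?_)
    have := hb b hbL
    have hle : a ≤ Finsupp.equivFunOnFinite.symm b ↔
        a 0 ≤ b 0 ∧ a 1 ≤ b 1 ∧ a 2 ≤ b 2 ∧ a 3 ≤ b 3 := by
      rw [Finsupp.le_def, Fin.forall_fin_succ, Fin.forall_fin_succ, Fin.forall_fin_two]
      rfl
    rw [coeff_sq_monomial, Function.comp_apply, Nat.cast_ite, Nat.cast_zero,
      Fin.sum_univ_four, Fin.prod_univ_four]
    refine if_congr ⟨fun h => hle.1 h.1, fun h => ⟨hle.2 h, ?_⟩⟩ rfl rfl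
    simp only [Finsupp.equivFunOnFinite_symm_apply_apply]
    omega
  · refine List.sum_eq_zero fun x hx => ?_
    obtain ⟨b, hbL, rfl⟩ := List.mem_map.1 hx
    have := hb b hbL
    rw [coeff_sq_monomial, if_neg]
    rintro ⟨h, hs⟩
    have h0 := h 0
    have h1 := h 1
    have h2 := h 2
    have h3 := h 3
    rw [Fin.sum_univ_four] at hs
    simp only [Finsupp.equivFunOnFinite_symm_apply_apply] at h0 h1 h2 h3 hs
    omega

theorem defect_eq : defect = monomial (Finsupp.equivFunOnFinite.symm ![3, 3, 4, 4]) 1 +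
    monomial (Finsupp.equivFunOnFinite.symm ![1, 1, 6, 6]) 1 := by
  rw [monomial_one_eq_prod, monomial_one_eq_prod, Fin.prod_univ_four, Fin.prod_univ_four, defect]
  simp only [word, pairMon]
  simp [fstIx, sndIx]
  ring

theorem defectFunctional_defect : defectFunctional defect = 1 := by
  have h : (defectSupport.map fun b => (if ![3, 3, 4, 4] = b then (1 : ZMod 2) else 0) +
      if ![1, 1, 6, 6] = b then 1 else 0).sum = 1 := by decide +kernel
  rw [defectFunctional_apply, defect_eq]
  simpa only [coeff_add, coeff_monomial, EmbeddingLike.apply_eq_iff_eq] using h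

theorem finrank_QP_eq_card {k n : ℕ} {ι : Type*} [Fintype ι] {w : ι → Poly k}
    (hw : ∀ i, (w i).IsHomogeneous n)
    (hspan : ∀ f : Poly k, f.IsHomogeneous n →
      f ∈ Submodule.span (ZMod 2) (Set.range w) ⊔ hitSubmodule k)
    (hind : ∀ c : ι → ZMod 2, ∑ i, c i • w i ∈ hitSubmodule k → ∀ i, c i = 0) :
    Module.finrank (ZMod 2) (QP k n) = Fintype.card ι := by
  set H := homogeneousSubmodule (Fin k) (ZMod 2) n
  set N := (hitSubmodule k).comap H.subtype
  let v : ι → H := fun i => ⟨w i, hw i⟩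
  have hv (c : ι → ZMod 2) : ((∑ i, c i • v i : H) : Poly k) = ∑ i, c i • w i := by
    simp [v]
  have hli : LinearIndependent (ZMod 2) fun i => N.mkQ (v i) := by
    rw [Fintype.linearIndependent_iff]
    intro c hc
    simp only [← map_smul, ← map_sum] at hc
    rw [← LinearMap.mem_ker, Submodule.ker_mkQ, Submodule.mem_comap, Submodule.subtype_apply,
      hv] at hc
    exact hind c hc
  have hsp : ⊤ ≤ Submodule.span (ZMod 2) (Set.range fun i => N.mkQ (v i)) := by
    rintro x -
    obtain ⟨f, rfl⟩ := N.mkQ_surjective x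
    obtain ⟨g, hg, h, hh, hgh⟩ := Submodule.mem_sup.1 (hspan f f.2)
    obtain ⟨c, rfl⟩ := (Submodule.mem_span_range_iff_exists_fun _).1 hg
    have hf : N.mkQ f = ∑ i, c i • N.mkQ (v i) := by
      simp only [← map_smul, ← map_sum]
      rw [← sub_eq_zero, ← map_sub, ← LinearMap.mem_ker, Submodule.ker_mkQ, Submodule.mem_comap,
        Submodule.subtype_apply, Submodule.coe_sub, hv, ← hgh, add_sub_cancel_left]
      exact hh
    rw [hf]
    exact sum_mem fun i _ => Submodule.smul_mem _ _ (Submodule.subset_span ⟨i, rfl⟩)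
  exact Module.finrank_eq_card_basis (Module.Basis.mk hli hsp)

theorem eq_zero_of_sum_add_mem {k : ℕ} {N : Submodule (ZMod 2) (Poly k)} {I : Finset ℕ}
    {w : ℕ → Poly k} {φ : ℕ → Poly k →ₗ[ZMod 2] ZMod 2} {g : Poly k}
    (hN : ∀ m, ∀ f ∈ N, φ m f = 0)
    (hφ : ∀ m ∈ I, ∀ m' ∈ I, φ m (w m') = if m' = m then 1 else 0)
    (hg : ∀ m, φ m g = 0) {c : I → ZMod 2} (h : ∑ i, c i • w i + g ∈ N) (m : I) : c m = 0 := by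
  rw [← hN m _ h, map_add, hg, add_zero, map_sum, Finset.sum_eq_single m]
  · rw [map_smul, hφ m m.2 m m.2, if_pos rfl, smul_eq_mul, mul_one]
  · intro i _ hi
    rw [map_smul, hφ m m.2 i i.2, if_neg fun h => hi (Subtype.ext h), smul_zero]
  · exact fun h => absurd (Finset.mem_univ m) h

/-- The elements whose classes form a basis in degree `2 ^ (s + 1) - 2`. -/
noncomputable def basisElement (s : ℕ) : evenIx s ⊕ {_u : Unit // s = 3} ⊕ liftedIx s → Poly 4 :=
  Sum.elim (fun m => stdWord s m) (Sum.elim (fun _ => defect) fun m => liftedOddWord (s - 2) m)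

theorem isHomogeneous_defect : defect.IsHomogeneous (2 ^ (3 + 1) - 2) :=
  (isHomogeneous_word [0, 0, 1]).add (isHomogeneous_word [0, 1, 1])

theorem mem_liftedIx {s m : ℕ} : m ∈ liftedIx s ↔ s ≠ 1 ∧ m ∈ oddIx (s - 2) := by
  by_cases h : s = 1 <;> simp [liftedIx, h]

theorem isHomogeneous_liftedOddWord {n m : ℕ} (hm : m ∈ oddIx n) :
    (liftedOddWord n m).IsHomogeneous (2 ^ (n + 2 + 1) - 2) := by
  have h := ((((isHomogeneous_X (ZMod 2) (0 : Fin 4)).mul (isHomogeneous_X _ 1)).mul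
    (isHomogeneous_X _ 2)).mul (isHomogeneous_X _ 3)).mul ((isHomogeneous_oddStdWord hm).pow 2)
  have := four_le_two_pow n
  rw [liftedOddWord]
  convert h using 1
  rw [pow_succ 2 (n + 2)]
  omega

theorem isHomogeneous_basisElement {s : ℕ} (hs : s ≠ 0) :
    ∀ i, (basisElement s i).IsHomogeneous (2 ^ (s + 1) - 2)
  | .inl ⟨m, hm⟩ => by
    simp only [evenIx, Finset.mem_filter] at hm
    have := isHomogeneous_word (padBits 6 s m)
    rwa [length_padBits hm.2] at this
  | .inr (.inl ⟨_, h⟩) => by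
    subst h
    exact isHomogeneous_defect
  | .inr (.inr ⟨m, hm⟩) => by
    obtain ⟨h1, h2⟩ := mem_liftedIx.1 hm
    have := isHomogeneous_liftedOddWord h2
    rwa [show s - 2 + 2 = s by omega] at this

theorem mem_span_basisElement {s : ℕ} (hs : s ≠ 0) {f : Poly 4}
    (hf : f.IsHomogeneous (2 ^ (s + 1) - 2)) :
    f ∈ Submodule.span (ZMod 2) (Set.range (basisElement s)) ⊔ hitSubmodule 4 := by
  refine SetLike.le_def.1 (sup_le_sup_right (sup_le (sup_le ?_ ?_) ?_) _) (mem_basis_span hs hf) <;>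
    refine Submodule.span_mono ?_
  · rintro _ ⟨m, hm, rfl⟩
    exact ⟨.inl ⟨m, hm⟩, rfl⟩
  · rintro _ ⟨h, rfl⟩
    exact ⟨.inr (.inl ⟨(), h⟩), rfl⟩
  · rintro _ ⟨m, hm, rfl⟩
    exact ⟨.inr (.inr ⟨m, hm⟩), rfl⟩

theorem eq_zero_of_sum_basisElement_mem_hit {s : ℕ} (hs : s ≠ 0)
    {c : evenIx s ⊕ {_u : Unit // s = 3} ⊕ liftedIx s → ZMod 2}
    (h : ∑ i, c i • basisElement s i ∈ hitSubmodule 4) : ∀ i, c i = 0 := by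
  simp only [Fintype.sum_sum_type, basisElement, Sum.elim_inl, Sum.elim_inr] at h
  have hk := kameko_mem_hit h
  simp only [map_add, map_sum, map_smul, kameko_defect, kameko_liftedOddWord,
    fun m : evenIx s => kameko_stdWord hs m.2, smul_zero, Finset.sum_const_zero, zero_add] at hk
  have hlift : ∀ m : liftedIx s, c (.inr (.inr m)) = 0 :=
    eq_zero_of_sum_add_mem (g := 0) (fun m f => oddFunctional_of_mem_hit (s - 2) m)
      (fun m hm m' hm' => oddFunctional_oddStdWord (mem_liftedIx.1 hm).2 (mem_liftedIx.1 hm').2)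
      (fun m => map_zero _) (by rwa [add_zero])
  simp only [hlift, zero_smul, Finset.sum_const_zero, add_zero] at h
  have heven : ∀ m : evenIx s, c (.inl m) = 0 := by
    refine eq_zero_of_sum_add_mem (fun m f => evenFunctional_of_mem_hit s m)
      (fun m hm m' hm' => evenFunctional_stdWord hm hm') (fun m => ?_) h
    rw [map_sum]
    refine Finset.sum_eq_zero fun u _ => ?_
    obtain ⟨_, rfl⟩ := u
    rw [map_smul, evenFunctional_defect, smul_zero]
  simp only [heven, zero_smul, Finset.sum_const_zero, zero_add] at h
  rintro (m | u | m)
  · exact heven m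
  · have h0 := defectFunctional_of_mem_hit h
    rwa [map_sum, Fintype.sum_subsingleton _ u, map_smul, defectFunctional_defect, smul_eq_mul,
      mul_one] at h0
  · exact hlift m

theorem finrank_QP_four {s : ℕ} (hs : s ≠ 0) : Module.finrank (ZMod 2) (QP 4 (2 ^ (s + 1) - 2)) =
    (evenIx s).card + ((if s = 3 then 1 else 0) + (liftedIx s).card) := by
  rw [finrank_QP_eq_card (isHomogeneous_basisElement hs) (fun _ => mem_span_basisElement hs)
    fun _ => eq_zero_of_sum_basisElement_mem_hit hs, Fintype.card_sum, Fintype.card_sum,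
    Fintype.card_coe, Fintype.card_coe]
  congr 2
  by_cases h : s = 3
  · rw [if_pos h, Fintype.card_eq_one_iff]
    exact ⟨⟨(), h⟩, fun _ => rfl⟩
  · rw [if_neg h, Fintype.card_eq_zero_iff]
    exact ⟨fun u => h u.2⟩

theorem evenIx_eq {s : ℕ} (hs : 4 ≤ s) : evenIx s = evenIx 4 := by
  have h : ∀ m ∈ stdMasks, (bits 6 m).length ≤ 4 := by decide +kernel
  rw [evenIx, evenIx]
  refine Finset.filter_congr fun m hm => ?_
  have := h m (List.mem_toFinset.1 hm)
  omega

theorem oddIx_eq {n : ℕ} (hn : 3 ≤ n) : oddIx n = oddIx 3 := by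
  have h : ∀ m ∈ oddStdMasks, (bits 4 (m / 4)).length ≤ 3 := by decide +kernel
  rw [oddIx, oddIx, if_neg (by omega), if_neg (by omega)]
  refine Finset.filter_congr fun m hm => ?_
  have := h m (List.mem_toFinset.1 hm)
  omega

end HitProblem

/-- `dim (QP_4)_{2^{s+1} - 2}` equals `6, 24, 50, 70, 80` for `s = 1, 2, 3, 4` and `s ≥ 5`. -/
theorem stmt10 (s : ℕ) (hs : 1 ≤ s) :
    (s = 1 → Module.finrank (ZMod 2) (QP 4 (2 ^ (s + 1) - 2)) = 6) ∧
    (s = 2 → Module.finrank (ZMod 2) (QP 4 (2 ^ (s + 1) - 2)) = 24) ∧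
    (s = 3 → Module.finrank (ZMod 2) (QP 4 (2 ^ (s + 1) - 2)) = 50) ∧
    (s = 4 → Module.finrank (ZMod 2) (QP 4 (2 ^ (s + 1) - 2)) = 70) ∧
    (5 ≤ s → Module.finrank (ZMod 2) (QP 4 (2 ^ (s + 1) - 2)) = 80) := by
  rw [HitProblem.finrank_QP_four (by omega)]
  refine ⟨?_, ?_, ?_, ?_, fun h => ?_⟩
  · rintro rfl
    decide +kernel
  · rintro rfl
    decide +kernel
  · rintro rfl
    decide +kernel
  · rintro rfl
    decide +kernel
  · rw [HitProblem.evenIx_eq (by omega), if_neg (by omega), HitProblem.liftedIx, if_neg (by omega),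
      HitProblem.oddIx_eq (by omega)]
    decide +kernel
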